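/- arXiv:2512.12845 — 2 statements merged into one kernel-verified Lean document; each statement's English description precedes it below -/
import Mathlib

section
/- Robustness theorem: Let T(t,s) be an evolution family on a Banach space X admitting a nonuniform exponential dichotomy with constants K, α > 0 and ε ≥ 0, and let B : ℝ → B(X) be continuous. Suppose there is an evolution family U(t,s) satisfying the perturbation identity U(t,s) = T(t,s) + ∫_s^t T(t,τ)B(τ)U(τ,s) dτ for t ≥ s. If q := 2K sup_{t∈ℝ} ∫_{−∞}^{∞} e^{−α|t−s|} ‖B(s)‖ e^{ε|s|} ds < 1, then U(t,s) also admits a nonuniform exponential dichotomy. -/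
open Real MeasureTheory

/-- An evolution family on `X` over `ℝ`. -/
def IsEvolutionFamily {X : Type*} [NormedAddCommGroup X] [NormedSpace ℝ X]
    (T : ℝ → ℝ → X →L[ℝ] X) : Prop :=
  (∀ t, T t t = 1) ∧
  (∀ r s t : ℝ, r ≤ s → s ≤ t → (T t s).comp (T s r) = T t r) ∧
  (∀ (x : X) (s : ℝ), ContinuousOn (fun t => T t s x) (Set.Ici s)) ∧
  (∀ (x : X) (t : ℝ), ContinuousOn (fun s => T t s x) (Set.Iic t))

/-- `T` admits a nonuniform exponential dichotomy with projections `P`, backward evolution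
`S` (acting as the inverse of `T(s,t)|_{Ker P(t)}`, extended by zero on `Ran P(s)`), and
constants `K, α > 0`, `ε ≥ 0`. -/
def HasNEDWith {X : Type*} [NormedAddCommGroup X] [NormedSpace ℝ X]
    (T : ℝ → ℝ → X →L[ℝ] X) (P : ℝ → X →L[ℝ] X) (S : ℝ → ℝ → X →L[ℝ] X)
    (K α ε : ℝ) : Prop :=
  0 < K ∧ 0 < α ∧ 0 ≤ ε ∧
  (∀ t, (P t).comp (P t) = P t) ∧
  (∀ s t : ℝ, s ≤ t → (T t s).comp (P s) = (P t).comp (T t s)) ∧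
  (∀ t s : ℝ, t ≤ s → (T s t).comp (S t s) = 1 - P s) ∧
  (∀ t s : ℝ, t ≤ s → (S t s).comp ((T s t).comp (1 - P t)) = 1 - P t) ∧
  (∀ t s : ℝ, t ≤ s → (S t s).comp (P s) = 0) ∧
  (∀ t s : ℝ, t ≤ s → (P t).comp (S t s) = 0) ∧
  (∀ s t : ℝ, s ≤ t → ‖(T t s).comp (P s)‖ ≤ K * Real.exp (-α * (t - s) + ε * |s|)) ∧
  (∀ t s : ℝ, t ≤ s → ‖S t s‖ ≤ K * Real.exp (-α * (s - t) + ε * |s|))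

/-- `T` admits a nonuniform exponential dichotomy. -/
def HasNED {X : Type*} [NormedAddCommGroup X] [NormedSpace ℝ X]
    (T : ℝ → ℝ → X →L[ℝ] X) : Prop :=
  ∃ (P : ℝ → X →L[ℝ] X) (S : ℝ → ℝ → X →L[ℝ] X) (K α ε : ℝ), HasNEDWith T P S K α ε


/-- Uniform integrability estimate with a smaller exponent. -/
lemma rob_weight_crude (b : ℝ → ℝ) (hb0 : ∀ s, 0 ≤ b s) (α γ M : ℝ) (hα : 0 < α) (hγ : 0 < γ)
    (hbm : Continuous b)
    (hint : ∀ t : ℝ, Integrable (fun s => Real.exp (-α * |t - s|) * b s))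
    (hM : ∀ t : ℝ, ∫ s, Real.exp (-α * |t - s|) * b s ≤ M) :
    ∃ C : ℝ, 0 ≤ C ∧ ∀ t, Integrable (fun s => Real.exp (-γ * |t - s|) * b s) ∧
      ∫ s, Real.exp (-γ * |t - s|) * b s ≤ C := by
  have hM0 : 0 ≤ M := le_trans (integral_nonneg (fun s => by have := hb0 s; positivity)) (hM 0)
  have hsum : Summable (fun n : ℤ => Real.exp (-γ * |(n : ℝ)|)) := by
    apply Summable.of_nat_of_neg
    · have := Real.summable_exp_nat_mul_iff.2 (neg_lt_zero.2 hγ)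
      refine this.congr fun n => ?_
      simp [mul_comm]
    · have := Real.summable_exp_nat_mul_iff.2 (neg_lt_zero.2 hγ)
      refine this.congr fun n => ?_
      simp [mul_comm]
  set D := ∑' n : ℤ, Real.exp (-γ * |(n : ℝ)|) with hD
  have hD0 : 0 ≤ D := tsum_nonneg fun n => (Real.exp_pos _).le
  refine ⟨Real.exp (γ + α) * (D * M), by positivity, fun t => ?_⟩
  have key : ∫⁻ s, ENNReal.ofReal (Real.exp (-γ * |t - s|) * b s) ≤
      ENNReal.ofReal (Real.exp (γ + α) * (D * M)) := by
    have h1 : ∀ s, ENNReal.ofReal (Real.exp (-γ * |t - s|) * b s) ≤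
        ∑' n : ℤ, ENNReal.ofReal (Real.exp (γ + α) * (Real.exp (-γ * |(n : ℝ)|) *
          (Real.exp (-α * |(t - n) - s|) * b s))) := by
      intro s
      refine le_trans ?_ (ENNReal.le_tsum ⌊t - s⌋)
      apply ENNReal.ofReal_le_ofReal
      set n := ⌊t - s⌋
      have hn1 : (n : ℝ) ≤ t - s := Int.floor_le _
      have hn2 : t - s < n + 1 := Int.lt_floor_add_one _
      have e : Real.exp (γ + α) * (Real.exp (-γ * |(n : ℝ)|) *
          (Real.exp (-α * |(t - n) - s|) * b s)) =
          Real.exp (γ + α + (-γ * |(n : ℝ)|) + (-α * |(t - n) - s|)) * b s := by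
        rw [Real.exp_add (γ + α + (-γ * |(n : ℝ)|)), Real.exp_add (γ + α)]; ring
      rw [e]
      apply mul_le_mul_of_nonneg_right _ (hb0 s)
      apply Real.exp_le_exp.2
      have a1 : |(t - n) - s| ≤ 1 := by rw [abs_le]; constructor <;> linarith
      have a2 : |(n : ℝ)| ≤ |t - s| + 1 := by
        have : (n : ℝ) = (t - s) - ((t - n) - s) := by ring
        rw [this]
        exact (abs_sub _ _).trans (by linarith)
      nlinarith
    calc _ ≤ ∫⁻ s, ∑' n : ℤ, ENNReal.ofReal (Real.exp (γ + α) * (Real.exp (-γ * |(n : ℝ)|) *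
          (Real.exp (-α * |(t - n) - s|) * b s))) := lintegral_mono h1
      _ = ∑' n : ℤ, ∫⁻ s, ENNReal.ofReal (Real.exp (γ + α) * (Real.exp (-γ * |(n : ℝ)|) *
          (Real.exp (-α * |(t - n) - s|) * b s))) := by
        rw [lintegral_tsum]
        intro n
        have : Continuous (fun s => Real.exp (γ + α) * (Real.exp (-γ * |(n : ℝ)|) *
          (Real.exp (-α * |(t - n) - s|) * b s))) := by fun_prop
        exact this.measurable.ennreal_ofReal.aemeasurable
      _ ≤ ∑' n : ℤ, ENNReal.ofReal (Real.exp (γ + α) * (Real.exp (-γ * |(n : ℝ)|) * M)) := by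
        apply ENNReal.tsum_le_tsum
        intro n
        rw [← ofReal_integral_eq_lintegral_ofReal (((hint _).const_mul _).const_mul _)
          (Filter.Eventually.of_forall fun s => by have := hb0 s; positivity)]
        apply ENNReal.ofReal_le_ofReal
        rw [integral_const_mul, integral_const_mul]
        gcongr
        exact hM _
      _ = _ := by
        rw [← ENNReal.ofReal_tsum_of_nonneg (fun n => by positivity)
          ((hsum.mul_right M).mul_left _), tsum_mul_left, tsum_mul_right]
  have hc : Continuous (fun s => Real.exp (-γ * |t - s|) * b s) := by fun_prop
  have hI : Integrable (fun s => Real.exp (-γ * |t - s|) * b s) := by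
    refine ⟨hc.aestronglyMeasurable, ?_⟩
    rw [hasFiniteIntegral_iff_ofReal
      (Filter.Eventually.of_forall fun s => by have := hb0 s; positivity)]
    exact key.trans_lt ENNReal.ofReal_lt_top
  refine ⟨hI, ?_⟩
  rw [← ofReal_integral_eq_lintegral_ofReal hI
    (Filter.Eventually.of_forall fun s => by have := hb0 s; positivity)] at key
  exact (ENNReal.ofReal_le_ofReal_iff (by positivity)).1 key

lemma rob_weight (b : ℝ → ℝ) (hb0 : ∀ s, 0 ≤ b s) (α K q : ℝ) (hα : 0 < α) (hK : 0 < K)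
    (hbm : Continuous b)
    (hint : ∀ t : ℝ, Integrable (fun s => Real.exp (-α * |t - s|) * b s))
    (hq1 : q < 1)
    (hq : ∀ t : ℝ, 2 * K * ∫ s, Real.exp (-α * |t - s|) * b s ≤ q) :
    ∃ β ρ : ℝ, 0 < β ∧ β < α ∧ 0 ≤ ρ ∧ ρ < 1 ∧ ∀ t,
      Integrable (fun s => Real.exp (-(α - β) * |t - s|) * b s) ∧
      K * ∫ s, Real.exp (-(α - β) * |t - s|) * b s ≤ ρ := by
  obtain ⟨C, hC0, hC⟩ := rob_weight_crude b hb0 α (α / 4) (q / (2 * K)) hα (by positivity) hbm hint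
    (fun t => by rw [le_div_iff₀ (by positivity)]; linarith [hq t])
  have hq0 : 0 ≤ q := le_trans (mul_nonneg (by positivity)
    (integral_nonneg (fun s => by have := hb0 s; positivity))) (hq 0)
  set A := 4 / α * C * K with hA
  have hA0 : 0 ≤ A := by positivity
  set β := min (α / 2) (1 / (4 * (A + 1))) with hβ
  have hβ0 : 0 < β := lt_min (by positivity) (by positivity)
  have hβ1 : β ≤ α / 2 := min_le_left _ _
  have hβ2 : β * A ≤ 1 / 4 := by
    have : β ≤ 1 / (4 * (A + 1)) := min_le_right _ _
    rw [le_div_iff₀ (by positivity)] at this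
    nlinarith
  refine ⟨β, 3 / 4, hβ0, by linarith, by norm_num, by norm_num, fun t => ?_⟩
  have pw : ∀ s, Real.exp (-(α - β) * |t - s|) * b s ≤
      Real.exp (-α * |t - s|) * b s + β * (4 / α) * (Real.exp (-(α / 4) * |t - s|) * b s) := by
    intro s
    have : Real.exp (-(α - β) * |t - s|) ≤
      Real.exp (-α * |t - s|) + β * (4 / α) * (Real.exp (-(α / 4) * |t - s|)) := by
      set u := |t - s|
      have hu : 0 ≤ u := abs_nonneg _
      have e1 : Real.exp (-α * u) = Real.exp (-(α - β) * u) * Real.exp (-(β * u)) := by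
        rw [← Real.exp_add]; congr 1; ring
      have e2 : 1 - β * u ≤ Real.exp (-(β * u)) := by
        have := Real.add_one_le_exp (-(β * u)); linarith
      have e3 : Real.exp (-(α - β) * u) ≤ Real.exp (-(α / 2) * u) := by
        apply Real.exp_le_exp.2; nlinarith
      have e4 : Real.exp (-(α / 4) * u) = Real.exp (-(α / 2) * u) * Real.exp (α / 4 * u) := by
        rw [← Real.exp_add]; congr 1; ring
      have e5 : α / 4 * u ≤ Real.exp (α / 4 * u) := by
        have := Real.add_one_le_exp (α / 4 * u); linarith
      have e6 : u ≤ 4 / α * Real.exp (α / 4 * u) := by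
        rw [div_mul_eq_mul_div, le_div_iff₀ hα]; linarith
      have p1 := Real.exp_pos (-(α - β) * u)
      have p2 := Real.exp_pos (-(α / 2) * u)
      calc Real.exp (-(α - β) * u) ≤ Real.exp (-α * u) + β * (u * Real.exp (-(α - β) * u)) := by
            rw [e1]; nlinarith
        _ ≤ Real.exp (-α * u) + β * ((4 / α * Real.exp (α / 4 * u)) * Real.exp (-(α / 2) * u)) := by
            gcongr
        _ = _ := by rw [e4]; ring
    have := mul_le_mul_of_nonneg_right this (hb0 s)
    linarith
  have hI2 : Integrable (fun s => Real.exp (-α * |t - s|) * b s +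
      β * (4 / α) * (Real.exp (-(α / 4) * |t - s|) * b s)) :=
    (hint t).add ((hC t).1.const_mul _)
  have hc : Continuous (fun s => Real.exp (-(α - β) * |t - s|) * b s) := by fun_prop
  have hI : Integrable (fun s => Real.exp (-(α - β) * |t - s|) * b s) := by
    refine hI2.mono' hc.aestronglyMeasurable (Filter.Eventually.of_forall fun s => ?_)
    rw [Real.norm_of_nonneg (by have := hb0 s; positivity)]
    exact pw s
  refine ⟨hI, ?_⟩
  have := integral_mono hI hI2 pw
  rw [integral_add (hint t) ((hC t).1.const_mul _), integral_const_mul] at this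
  have h3 := (hC t).2
  have h4 : β * (4 / α) * ∫ s, Real.exp (-(α / 4) * |t - s|) * b s ≤ β * (4 / α) * C := by
    gcongr
  have h5 := hq t
  have h6 : K * (β * (4 / α) * C) = β * A := by rw [hA]; ring
  have := mul_le_mul_of_nonneg_left (this.trans (add_le_add_right h4 _)) hK.le
  nlinarith

/-- The Green kernel. -/
noncomputable def robG {X : Type*} [NormedAddCommGroup X] [NormedSpace ℝ X]
    (T : ℝ → ℝ → X →L[ℝ] X) (P : ℝ → X →L[ℝ] X) (S : ℝ → ℝ → X →L[ℝ] X) (τ σ : ℝ) : X →L[ℝ] X :=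
  if σ ≤ τ then (T τ σ).comp (P σ) else -(S τ σ)

/-- What is needed of the Green kernel. -/
structure RobKern {X : Type*} [NormedAddCommGroup X] [NormedSpace ℝ X]
    (T G : ℝ → ℝ → X →L[ℝ] X) (B : ℝ → X →L[ℝ] X) (K α ε β ρ : ℝ) : Prop where
  K0 : 0 < K
  α0 : 0 < α
  ε0 : 0 ≤ ε
  β0 : 0 < β
  βα : β < α
  ρ0 : 0 ≤ ρ
  ρ1 : ρ < 1
  Bc : Continuous B
  c1 : ∀ τ x, ContinuousOn (fun σ => G τ σ x) {τ}ᶜ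
  c2 : ∀ σ x, ContinuousOn (fun τ => G τ σ x) {σ}ᶜ
  bd : ∀ τ σ, ‖G τ σ‖ ≤ K * Real.exp (-α * |τ - σ| + ε * |σ|)
  int : ∀ t, Integrable (fun s => Real.exp (-(α - β) * |t - s|) * (‖B s‖ * Real.exp (ε * |s|)))
  intb : ∀ t, K * ∫ s, Real.exp (-(α - β) * |t - s|) * (‖B s‖ * Real.exp (ε * |s|)) ≤ ρ
  k1 : ∀ τ r σ x, G τ r (G r σ x) = (if r ≤ τ then G τ σ x else 0) - (if r < σ then G τ σ x else 0)
  k2 : ∀ τ σ t x, σ ≤ t → G τ σ x = G τ t (T t σ x) + (if σ ≤ τ ∧ τ < t then T τ σ x else 0)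
  k3 : ∀ t τ σ x, t ≤ τ → G τ σ x = T τ t (G t σ x) + (if t < σ ∧ σ ≤ τ then T τ σ x else 0)

section
variable {X : Type*} [NormedAddCommGroup X] [NormedSpace ℝ X]

lemma rob_kern (T : ℝ → ℝ → X →L[ℝ] X)
    (hT : IsEvolutionFamily T)
    (P : ℝ → X →L[ℝ] X) (S : ℝ → ℝ → X →L[ℝ] X) (K α ε : ℝ)
    (hned : HasNEDWith T P S K α ε)
    (B : ℝ → X →L[ℝ] X) (hB : Continuous B)
    (hBint : ∀ t : ℝ,
      Integrable (fun s => Real.exp (-α * |t - s|) * (‖B s‖ * Real.exp (ε * |s|))))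
    (q : ℝ) (hq1 : q < 1)
    (hq : ∀ t : ℝ,
      2 * K * ∫ s, Real.exp (-α * |t - s|) * (‖B s‖ * Real.exp (ε * |s|)) ≤ q) :
    ∃ β ρ, RobKern T (robG T P S) B K α ε β ρ := by
  obtain ⟨hT1, hTc, hTf, hTb⟩ := hT
  obtain ⟨hK, hα, hε, hPP, hTP, hTS, hST, hSP, hPS, hb1, hb2⟩ := hned
  obtain ⟨β, ρ, h1, h2, h3, h4, h5⟩ := rob_weight (fun s => ‖B s‖ * Real.exp (ε * |s|))
    (fun s => by positivity) α K q hα hK (by fun_prop) hBint hq1 hq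
  have aTc : ∀ r s t : ℝ, r ≤ s → s ≤ t → ∀ x, T t s (T s r x) = T t r x :=
    fun r s t a b x => by rw [← hTc r s t a b]; rfl
  have aPP : ∀ t x, P t (P t x) = P t x := fun t x => DFunLike.congr_fun (hPP t) x
  have aTP : ∀ s t, s ≤ t → ∀ x, T t s (P s x) = P t (T t s x) :=
    fun s t h x => DFunLike.congr_fun (hTP s t h) x
  have aTS : ∀ t s, t ≤ s → ∀ x, T s t (S t s x) = x - P s x :=
    fun s t h x => DFunLike.congr_fun (hTS s t h) x
  have aST : ∀ t s, t ≤ s → ∀ x, S t s (T s t (x - P t x)) = x - P t x :=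
    fun s t h x => DFunLike.congr_fun (hST s t h) x
  have aSP : ∀ t s, t ≤ s → ∀ x, S t s (P s x) = 0 :=
    fun s t h x => DFunLike.congr_fun (hSP s t h) x
  have aPS : ∀ t s, t ≤ s → ∀ x, P t (S t s x) = 0 :=
    fun s t h x => DFunLike.congr_fun (hPS s t h) x
  have aT1 : ∀ t x, T t t x = x := fun t x => by rw [hT1]; rfl
  -- S τ σ T σ r = S τ r
  have b1 : ∀ τ r σ, τ ≤ r → r ≤ σ → ∀ x, S τ σ (T σ r x) = S τ r x := by
    intro τ r σ h h' x
    have e1 : S τ σ (T σ r x) = S τ σ (T σ r (x - P r x)) := by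
      rw [map_sub, map_sub, aTP _ _ h', aSP _ _ (h.trans h'), sub_zero]
    rw [e1, ← aTS τ r h, aTc _ _ _ h h']
    have := aST τ σ (h.trans h') (S τ r x)
    rwa [aPS _ _ h, sub_zero] at this
  have b0 : ∀ τ x, S τ τ x = x - P τ x := fun τ x => by
    have := aTS τ τ le_rfl x
    rwa [aT1] at this
  have b2 : ∀ τ r σ, τ ≤ r → r ≤ σ → ∀ x, S τ r (S r σ x) = S τ σ x := by
    intro τ r σ h h' x
    rw [← b1 τ r σ h h', aTS _ _ h', map_sub, aSP _ _ (h.trans h'), sub_zero]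
  have b3 : ∀ t τ σ, t ≤ τ → τ ≤ σ → ∀ x, T τ t (S t σ x) = S τ σ x := by
    intro t τ σ h h' x
    have e : S τ σ (T σ τ (T τ t (S t σ x))) = S τ σ x := by
      rw [aTc _ _ _ h h', aTS _ _ (h.trans h'), map_sub, aSP _ _ h', sub_zero]
    rw [← e, b1 _ _ _ le_rfl h', b0, ← aTP _ _ h, aPS _ _ (h.trans h'), map_zero, sub_zero]
  refine ⟨β, ρ, hK, hα, hε, h1, h2, h3, h4, hB, ?_, ?_, ?_, fun t => (h5 t).1, fun t => (h5 t).2,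
    ?_, ?_, ?_⟩
  · intro τ x σ₀ hσ
    apply ContinuousAt.continuousWithinAt
    rcases lt_or_gt_of_ne (show σ₀ ≠ τ from hσ) with h | h
    · have : ContinuousAt (fun σ => P τ (T τ σ x)) σ₀ :=
        (P τ).continuous.continuousAt.comp ((hTb x τ).continuousAt (Iic_mem_nhds h))
      refine this.congr ?_
      filter_upwards [Iio_mem_nhds h] with σ hs
      have hs : σ ≤ τ := le_of_lt hs
      simp only [robG, if_pos hs, ContinuousLinearMap.comp_apply, aTP _ _ hs]
    · have : ContinuousAt (fun σ => -(S τ (σ₀ + 1) (T (σ₀ + 1) σ x))) σ₀ :=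
        ((S τ (σ₀ + 1)).continuous.continuousAt.comp
          ((hTb x (σ₀ + 1)).continuousAt (Iic_mem_nhds (by linarith)))).neg
      refine this.congr ?_
      filter_upwards [Ioo_mem_nhds h (show σ₀ < σ₀ + 1 by linarith)] with σ hs
      simp only [robG, if_neg (not_le.2 hs.1), neg_apply]
      rw [b1 _ _ _ hs.1.le hs.2.le]
  · intro σ x τ₀ hτ
    apply ContinuousAt.continuousWithinAt
    rcases lt_or_gt_of_ne (show τ₀ ≠ σ from hτ) with h | h
    · have : ContinuousAt (fun τ => -(T τ (τ₀ - 1) (S (τ₀ - 1) σ x))) τ₀ :=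
        ((hTf _ (τ₀ - 1)).continuousAt (Ici_mem_nhds (by linarith))).neg
      refine this.congr ?_
      filter_upwards [Ioo_mem_nhds (show τ₀ - 1 < τ₀ by linarith) h] with τ hs
      simp only [robG, if_neg (not_le.2 hs.2), neg_apply]
      rw [b3 _ _ _ hs.1.le hs.2.le]
    · have : ContinuousAt (fun τ => T τ σ (P σ x)) τ₀ :=
        (hTf _ σ).continuousAt (Ici_mem_nhds h)
      refine this.congr ?_
      filter_upwards [Ioi_mem_nhds h] with τ hs
      have hs : σ ≤ τ := le_of_lt hs
      simp only [robG, if_pos hs, ContinuousLinearMap.comp_apply]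
  · intro τ σ
    unfold robG
    split_ifs with h
    · rw [abs_of_nonneg (sub_nonneg.2 h)]; exact hb1 σ τ h
    · push Not at h
      rw [norm_neg, abs_sub_comm, abs_of_nonneg (sub_nonneg.2 h.le)]; exact hb2 τ σ h.le
  · intro τ r σ x
    by_cases h1 : r ≤ τ <;> by_cases h2 : r < σ
    · simp only [robG, if_pos h1, if_pos h2, if_neg (not_le.2 h2), neg_apply,
        ContinuousLinearMap.comp_apply, sub_self, map_neg, aPS _ _ h2.le, map_zero, neg_zero]
    · have h2' := not_lt.1 h2
      simp only [robG, if_pos h1, if_neg h2, if_pos h2', if_pos (h2'.trans h1),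
        ContinuousLinearMap.comp_apply, sub_zero]
      rw [aTP _ _ h2', aPP, ← aTP _ _ h2', aTc _ _ _ h2' h1]
    · have h1' := (not_le.1 h1)
      simp only [robG, if_neg h1, if_pos h2, if_neg (not_le.2 h2), if_neg (not_le.2 (h1'.trans h2)),
        neg_apply, map_neg, neg_neg, zero_sub]
      rw [b2 _ _ _ h1'.le h2.le]
    · have h1' := (not_le.1 h1)
      have h2' := not_lt.1 h2
      simp only [robG, if_neg h1, if_neg h2, if_pos h2', ContinuousLinearMap.comp_apply,
        neg_apply, sub_self, aTP _ _ h2', aSP _ _ h1'.le, neg_zero]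
  · intro τ σ t x h
    by_cases h1 : t ≤ τ
    · have : ¬ (σ ≤ τ ∧ τ < t) := fun a => absurd a.2 (not_lt.2 h1)
      simp only [robG, if_pos h1, if_neg this, if_pos (h.trans h1), ContinuousLinearMap.comp_apply,
        add_zero]
      rw [← aTP _ _ h, aTc _ _ _ h h1]
    · have h1' := not_le.1 h1
      by_cases h2 : σ ≤ τ
      · simp only [robG, if_neg h1, if_pos h2, if_pos (And.intro h2 h1'),
          ContinuousLinearMap.comp_apply, neg_apply]
        rw [← aTc _ _ _ h2 h1'.le, b1 _ _ _ le_rfl h1'.le, b0, aTP _ _ h2]; abel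
      · simp only [robG, if_neg h1, h2, false_and, if_false, add_zero,
          neg_apply]
        rw [b1 _ _ _ (not_le.1 h2).le h]
  · intro t τ σ x h
    by_cases h1 : t < σ
    · by_cases h2 : σ ≤ τ
      · simp only [robG, if_neg (not_le.2 h1), if_pos h2, if_pos (And.intro h1 h2),
          ContinuousLinearMap.comp_apply, neg_apply, map_neg]
        rw [← aTc _ _ _ h1.le h2, aTS _ _ h1.le, map_sub]; abel
      · simp only [robG, if_neg (not_le.2 h1), h2, and_false, if_false, add_zero,
          neg_apply, map_neg]
        rw [b3 _ _ _ h (not_le.1 h2).le]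
    · have h1' := not_lt.1 h1
      simp only [robG, if_pos h1', if_pos (h1'.trans h), h1, false_and, if_false, add_zero,
        ContinuousLinearMap.comp_apply]
      rw [aTc _ _ _ h1' h]
end

section
variable {X : Type*} [NormedAddCommGroup X] [NormedSpace ℝ X]

lemma rob_meas_clm (A : ℝ → X →L[ℝ] X) (hA : ∀ x, AEStronglyMeasurable (fun σ => A σ x) volume)
    (y : ℝ → X) (hy : AEStronglyMeasurable y volume) :
    AEStronglyMeasurable (fun σ => A σ (y σ)) volume := by
  obtain ⟨y', hy', hyy⟩ := hy
  have h1 : ∀ f : SimpleFunc ℝ X, AEStronglyMeasurable (fun σ => A σ (f σ)) volume := by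
    intro f
    have : (fun σ => A σ (f σ)) =
        ∑ x ∈ f.range, (f ⁻¹' {x}).indicator (fun σ => A σ x) := by
      funext σ
      rw [Finset.sum_apply, Finset.sum_eq_single (f σ)]
      · simp
      · intro b _ hb
        rw [Set.indicator_of_notMem]
        simpa using hb.symm
      · intro h
        exact absurd (SimpleFunc.mem_range_self f σ) h
    rw [this]
    exact Finset.aestronglyMeasurable_sum _ fun x _ =>
      (hA x).indicator (f.measurableSet_preimage _)
  have h2 : AEStronglyMeasurable (fun σ => A σ (y' σ)) volume := by
    refine aestronglyMeasurable_of_tendsto_ae Filter.atTop (fun n => h1 (hy'.approx n)) ?_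
    exact Filter.Eventually.of_forall fun σ =>
      ((A σ).continuous.tendsto _).comp (hy'.tendsto_approx σ)
  refine h2.congr ?_
  filter_upwards [hyy] with σ hσ
  rw [hσ]

lemma rob_meas_compl (f : ℝ → X) (a : ℝ) (hf : ContinuousOn f {a}ᶜ) :
    AEStronglyMeasurable f volume := by
  have := hf.aestronglyMeasurable (μ := volume) (measurableSet_singleton a).compl
  rwa [Measure.restrict_eq_self_of_ae_mem] at this
  exact compl_mem_ae_iff.2 (by simp)

lemma rob_ae_ne (a : ℝ) : ∀ᵐ σ : ℝ, σ ≠ a := by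
  simpa using (Set.countable_singleton a).ae_notMem volume

variable {T G : ℝ → ℝ → X →L[ℝ] X} {B : ℝ → X →L[ℝ] X} {K α ε β ρ : ℝ}

lemma RobKern.meas (h : RobKern T G B K α ε β ρ) (y : ℝ → X) (hy : AEStronglyMeasurable y volume)
    (τ : ℝ) : AEStronglyMeasurable (fun σ => G τ σ (B σ (y σ))) volume := by
  refine rob_meas_clm (G τ) (fun x => rob_meas_compl _ τ (h.c1 τ x)) _ ?_
  refine rob_meas_clm B (fun x => ?_) _ hy
  exact ((h.Bc).clm_apply continuous_const).aestronglyMeasurable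

lemma RobKern.pt (h : RobKern T G B K α ε β ρ) {β' C s τ σ : ℝ} (hβ0 : 0 ≤ β') (hβ1 : β' ≤ β)
    {v : X} (hv : ‖v‖ ≤ C * Real.exp (-β' * |σ - s|)) :
    ‖G τ σ (B σ v)‖ ≤ (C * Real.exp (-β' * |τ - s|)) *
      (K * (Real.exp (-(α - β) * |τ - σ|) * (‖B σ‖ * Real.exp (ε * |σ|)))) := by
  have hC : 0 ≤ C := by
    by_contra hc
    have := Real.exp_pos (-β' * |σ - s|)
    have := norm_nonneg v
    nlinarith
  have hK := h.K0
  have e1 : -α * |τ - σ| + -β' * |σ - s| ≤ -β' * |τ - s| + -(α - β) * |τ - σ| := by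
    have h1 : |τ - s| ≤ |τ - σ| + |σ - s| := abs_sub_le _ _ _
    have h2 := abs_nonneg (τ - σ)
    nlinarith
  calc ‖G τ σ (B σ v)‖ ≤ ‖G τ σ‖ * (‖B σ‖ * ‖v‖) :=
        ((G τ σ).le_opNorm _).trans (by gcongr; exact (B σ).le_opNorm _)
    _ ≤ (K * Real.exp (-α * |τ - σ| + ε * |σ|)) * (‖B σ‖ * (C * Real.exp (-β' * |σ - s|))) := by
        gcongr
        exact h.bd τ σ
    _ = (C * K * ‖B σ‖ * Real.exp (ε * |σ|)) * Real.exp (-α * |τ - σ| + -β' * |σ - s|) := by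
        rw [Real.exp_add, Real.exp_add]; ring
    _ ≤ (C * K * ‖B σ‖ * Real.exp (ε * |σ|)) * Real.exp (-β' * |τ - s| + -(α - β) * |τ - σ|) := by
        gcongr
    _ = _ := by rw [Real.exp_add]; ring

lemma RobKern.integrable (h : RobKern T G B K α ε β ρ) (y : ℝ → X)
    (hy : AEStronglyMeasurable y volume) (hb : ∃ C, ∀ τ, ‖y τ‖ ≤ C) (τ : ℝ) :
    Integrable (fun σ => G τ σ (B σ (y σ))) := by
  obtain ⟨C, hC⟩ := hb
  refine Integrable.mono' (((h.int τ).const_mul K).const_mul (C * Real.exp (-0 * |τ - 0|)))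
    (h.meas y hy τ) (Filter.Eventually.of_forall fun σ => ?_)
  exact h.pt le_rfl h.β0.le (s := 0) (by simpa using hC σ)

lemma RobKern.norm_le (h : RobKern T G B K α ε β ρ) (y : ℝ → X)
    {β' C s : ℝ} (hβ0 : 0 ≤ β') (hβ1 : β' ≤ β)
    (hb : ∀ σ, ‖y σ‖ ≤ C * Real.exp (-β' * |σ - s|)) (τ : ℝ) :
    ∫ σ, ‖G τ σ (B σ (y σ))‖ ≤ C * ρ * Real.exp (-β' * |τ - s|) := by
  have hC : 0 ≤ C := by
    have := (norm_nonneg _).trans (hb s)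
    simpa using this
  have := integral_mono_of_nonneg (μ := volume)
    (Filter.Eventually.of_forall fun σ => norm_nonneg (G τ σ (B σ (y σ))))
    (((h.int τ).const_mul K).const_mul (C * Real.exp (-β' * |τ - s|)))
    (Filter.Eventually.of_forall fun σ => h.pt hβ0 hβ1 (hb σ))
  refine this.trans ?_
  rw [integral_const_mul, integral_const_mul]
  have h2 := mul_le_mul_of_nonneg_left (h.intb τ)
    (show 0 ≤ C * Real.exp (-β' * |τ - s|) by positivity)
  linarith

lemma RobKern.cont (h : RobKern T G B K α ε β ρ) (y : ℝ → X)
    (hy : AEStronglyMeasurable y volume) (hb : ∃ C, ∀ τ, ‖y τ‖ ≤ C) :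
    Continuous (fun τ => ∫ σ, G τ σ (B σ (y σ))) := by
  obtain ⟨C, hC⟩ := hb
  have hC0 : 0 ≤ C := (norm_nonneg _).trans (hC 0)
  have hK := h.K0
  have hαβ : 0 < α - β := sub_pos.2 h.βα
  rw [continuous_iff_continuousAt]
  intro τ₀
  refine continuousAt_of_dominated (bound := fun σ => C * Real.exp (α - β) *
      (K * (Real.exp (-(α - β) * |τ₀ - σ|) * (‖B σ‖ * Real.exp (ε * |σ|)))))
    (Filter.Eventually.of_forall fun τ => h.meas y hy τ) ?_
    (((h.int τ₀).const_mul K).const_mul _) ?_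
  · filter_upwards [Metric.ball_mem_nhds τ₀ one_pos] with τ hτ
    refine Filter.Eventually.of_forall fun σ => ?_
    have := h.pt (τ := τ) (σ := σ) le_rfl h.β0.le (s := 0) (C := C) (by simpa using hC σ)
    refine this.trans ?_
    have e : Real.exp (-(α - β) * |τ - σ|) ≤
        Real.exp (α - β) * Real.exp (-(α - β) * |τ₀ - σ|) := by
      rw [← Real.exp_add]
      apply Real.exp_le_exp.2
      have h1 : |τ₀ - σ| ≤ |τ₀ - τ| + |τ - σ| := abs_sub_le _ _ _
      have h2 : |τ₀ - τ| < 1 := by rw [abs_sub_comm]; simpa [Real.dist_eq] using hτ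
      nlinarith
    have e2 : C * Real.exp (-0 * |τ - 0|) = C := by simp
    rw [e2]
    calc _ ≤ C * (K * ((Real.exp (α - β) * Real.exp (-(α - β) * |τ₀ - σ|)) *
          (‖B σ‖ * Real.exp (ε * |σ|)))) := by gcongr
      _ = _ := by ring
  · filter_upwards [rob_ae_ne τ₀] with σ hσ
    exact (h.c2 σ _).continuousAt (isOpen_compl_singleton.mem_nhds (Ne.symm hσ))

/-- Bounded measurable solutions of the Green equation. -/
def RobSol (G : ℝ → ℝ → X →L[ℝ] X) (B : ℝ → X →L[ℝ] X) (f y : ℝ → X) : Prop :=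
  AEStronglyMeasurable y volume ∧ (∃ C, ∀ τ, ‖y τ‖ ≤ C) ∧
    ∀ τ, y τ = f τ + ∫ σ, G τ σ (B σ (y σ))

lemma RobKern.sol_add (h : RobKern T G B K α ε β ρ) {f g y w : ℝ → X}
    (h1 : RobSol G B f y) (h2 : RobSol G B g w) :
    RobSol G B (fun τ => f τ + g τ) (fun τ => y τ + w τ) := by
  have i1 := h.integrable y h1.1 h1.2.1
  have i2 := h.integrable w h2.1 h2.2.1
  obtain ⟨m1, ⟨C1, b1⟩, e1⟩ := h1
  obtain ⟨m2, ⟨C2, b2⟩, e2⟩ := h2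
  refine ⟨m1.add m2, ⟨C1 + C2, fun τ => (norm_add_le _ _).trans (add_le_add (b1 τ) (b2 τ))⟩,
    fun τ => ?_⟩
  simp only [map_add]
  rw [integral_add (i1 τ) (i2 τ), e1 τ, e2 τ]
  rw [← e1 τ, ← e2 τ]
  nth_rewrite 1 [e1 τ, e2 τ]
  abel

lemma RobSol.smul {f y : ℝ → X} (c : ℝ)
    (h1 : RobSol G B f y) : RobSol G B (fun τ => c • f τ) (fun τ => c • y τ) := by
  obtain ⟨m1, ⟨C1, b1⟩, e1⟩ := h1
  refine ⟨m1.const_smul c, ⟨‖c‖ * C1, fun τ => ?_⟩, fun τ => ?_⟩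
  · rw [norm_smul]; exact mul_le_mul_of_nonneg_left (b1 τ) (norm_nonneg _)
  · simp only [map_smul]
    rw [integral_smul, ← smul_add, ← e1 τ]

lemma RobKern.sol_sub (h : RobKern T G B K α ε β ρ) {f g y w : ℝ → X}
    (h1 : RobSol G B f y) (h2 : RobSol G B g w) :
    RobSol G B (fun τ => f τ - g τ) (fun τ => y τ - w τ) := by
  have := h.sol_add h1 (h2.smul (-1))
  simpa [sub_eq_add_neg] using this

lemma RobKern.sol_zero (h : RobKern T G B K α ε β ρ) {y : ℝ → X}
    (h1 : RobSol G B (fun _ => 0) y) : ∀ τ, y τ = 0 := by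
  obtain ⟨m1, ⟨C, b⟩, e⟩ := h1
  have hn : ∀ n : ℕ, ∀ τ, ‖y τ‖ ≤ C * ρ ^ n := by
    intro n
    induction n with
    | zero => simpa using b
    | succ n ih =>
      intro τ
      have := h.norm_le y (C := C * ρ ^ n) (s := 0) le_rfl h.β0.le (by simpa using ih) τ
      rw [e τ, zero_add]
      refine (norm_integral_le_integral_norm _).trans (this.trans ?_)
      simp [pow_succ, mul_assoc]
  intro τ
  have ht : Filter.Tendsto (fun n : ℕ => C * ρ ^ n) Filter.atTop (nhds (C * 0)) :=
    (tendsto_pow_atTop_nhds_zero_of_lt_one h.ρ0 h.ρ1).const_mul C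
  have := ge_of_tendsto' ht (fun n => hn n τ)
  rw [mul_zero] at this
  exact norm_le_zero_iff.1 this

lemma RobKern.sol_unique (h : RobKern T G B K α ε β ρ) {f y w : ℝ → X}
    (h1 : RobSol G B f y) (h2 : RobSol G B f w) : ∀ τ, y τ = w τ := by
  have := h.sol_sub h1 h2
  simp only [sub_self] at this
  intro τ
  exact sub_eq_zero.1 (h.sol_zero this τ)

lemma RobKern.sol_exists [CompleteSpace X] (h : RobKern T G B K α ε β ρ) (s : ℝ) (x : X) :
    ∃ z, RobSol G B (fun τ => G τ s x) z ∧
      ∀ τ, ‖z τ‖ ≤ (K / (1 - ρ) * Real.exp (-β * (|τ - s|) + ε * |s|)) * ‖x‖ := by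
  have hK := h.K0
  have hρ : 0 < 1 - ρ := sub_pos.2 h.ρ1
  set A := K * Real.exp (ε * |s|) * ‖x‖ with hA
  have hA0 : 0 ≤ A := by positivity
  let z : ℕ → ℝ → X := fun n => Nat.rec (fun τ => G τ s x)
    (fun _ w => fun τ => ∫ σ, G τ σ (B σ (w σ))) n
  have z0 : ∀ τ, z 0 τ = G τ s x := fun τ => rfl
  have zs : ∀ n τ, z (n + 1) τ = ∫ σ, G τ σ (B σ (z n σ)) := fun n τ => rfl
  have hb : ∀ n τ, ‖z n τ‖ ≤ (A * ρ ^ n) * Real.exp (-β * |τ - s|) := by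
    intro n
    induction n with
    | zero =>
      intro τ
      rw [z0, pow_zero, mul_one]
      calc ‖G τ s x‖ ≤ (K * Real.exp (-α * |τ - s| + ε * |s|)) * ‖x‖ :=
            (G τ s).le_of_opNorm_le (h.bd τ s) x
        _ ≤ (K * Real.exp (-β * |τ - s| + ε * |s|)) * ‖x‖ := by
            gcongr ?_ * ?_ * ‖x‖
            apply Real.exp_le_exp.2
            have := abs_nonneg (τ - s)
            have := h.βα
            nlinarith
        _ = _ := by rw [Real.exp_add, hA]; ring
    | succ n ih =>
      intro τ
      rw [zs]
      refine (norm_integral_le_integral_norm _).trans ?_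
      refine (h.norm_le (z n) h.β0.le le_rfl ih τ).trans (le_of_eq ?_)
      rw [pow_succ]; ring
  have hb' : ∀ n τ, ‖z n τ‖ ≤ A * ρ ^ n := by
    intro n τ
    refine (hb n τ).trans ?_
    have : Real.exp (-β * |τ - s|) ≤ 1 := by
      apply Real.exp_le_one_iff.2
      have := abs_nonneg (τ - s)
      have := h.β0
      nlinarith
    have h2 : 0 ≤ A * ρ ^ n := mul_nonneg hA0 (pow_nonneg h.ρ0 n)
    nlinarith
  have hm : ∀ n, AEStronglyMeasurable (z n) volume := by
    intro n
    induction n with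
    | zero => exact rob_meas_compl _ s (h.c2 s x)
    | succ n ih => exact (h.cont (z n) ih ⟨_, hb' n⟩).aestronglyMeasurable
  have hgeo : Summable (fun n : ℕ => A * ρ ^ n) :=
    (summable_geometric_of_lt_one h.ρ0 h.ρ1).mul_left A
  have hsum : ∀ τ, Summable (fun n => z n τ) := fun τ =>
    Summable.of_norm_bounded hgeo (fun n => hb' n τ)
  refine ⟨fun τ => ∑' n, z n τ, ⟨?_, ⟨A * (1 - ρ)⁻¹, fun τ => ?_⟩, fun τ => ?_⟩, fun τ => ?_⟩
  · refine aestronglyMeasurable_of_tendsto_ae Filter.atTop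
      (f := fun (n : ℕ) τ => ∑ i ∈ Finset.range n, z i τ) (fun n => ?_)
      (Filter.Eventually.of_forall fun τ => (hsum τ).hasSum.tendsto_sum_nat)
    exact Finset.aestronglyMeasurable_fun_sum _ (fun i _ => hm i)
  · refine tsum_of_norm_bounded ?_ (fun n => hb' n τ)
    exact (hasSum_geometric_of_lt_one h.ρ0 h.ρ1).mul_left A
  · have i1 : ∀ n, Integrable (fun σ => G τ σ (B σ (z n σ))) := fun n =>
      h.integrable (z n) (hm n) ⟨_, hb' n⟩ τ
    have i2 : Summable (fun n => ∫ σ, ‖G τ σ (B σ (z n σ))‖) := by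
      refine Summable.of_nonneg_of_le (fun n => integral_nonneg fun σ => norm_nonneg _)
        (fun n => ?_) (hgeo.mul_right ρ)
      have := h.norm_le (z n) (s := 0) (C := A * ρ ^ n) le_rfl h.β0.le (by simpa using hb' n) τ
      simpa using this
    have i3 := (hasSum_integral_of_summable_integral_norm i1 i2).tsum_eq
    have i4 : ∀ σ, ∑' n, G τ σ (B σ (z n σ)) = G τ σ (B σ (∑' n, z n σ)) := fun σ => by
      rw [(B σ).map_tsum (hsum σ), (G τ σ).map_tsum ((B σ).summable (hsum σ))]
    simp only [i4] at i3
    show ∑' n, z n τ = G τ s x + _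
    rw [← i3, (hsum τ).tsum_eq_zero_add, z0]
  · refine (tsum_of_norm_bounded ?_ (fun n => hb n τ)).trans
      (le_of_eq (a := A * (1 - ρ)⁻¹ * Real.exp (-β * |τ - s|)) ?_)
    · exact ((hasSum_geometric_of_lt_one h.ρ0 h.ρ1).mul_left A).mul_right _
    · rw [hA, Real.exp_add]; field_simp

lemma RobKern.green [CompleteSpace X] (h : RobKern T G B K α ε β ρ) :
    ∃ H : ℝ → ℝ → X →L[ℝ] X, (∀ s x, RobSol G B (fun τ => G τ s x) (fun τ => H τ s x)) ∧
      ∀ τ s, ‖H τ s‖ ≤ K / (1 - ρ) * Real.exp (-β * (|τ - s|) + ε * |s|) := by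
  choose z hz hzb using h.sol_exists
  have hK := h.K0
  have hρ : 0 < 1 - ρ := sub_pos.2 h.ρ1
  let H : ℝ → ℝ → X →L[ℝ] X := fun τ s => LinearMap.mkContinuous
    { toFun := fun x => z s x τ
      map_add' := fun x y => by
        have := h.sol_add (hz s x) (hz s y)
        simp only [← map_add] at this
        exact h.sol_unique (hz s (x + y)) this τ
      map_smul' := fun c x => by
        have := (hz s x).smul c
        simp only [← map_smul] at this
        exact h.sol_unique (hz s (c • x)) this τ }
    (K / (1 - ρ) * Real.exp (-β * (|τ - s|) + ε * |s|)) (fun x => hzb s x τ)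
  refine ⟨H, fun s x => hz s x, fun τ s => ?_⟩
  exact LinearMap.mkContinuous_norm_le _ (by positivity) _
end

section
variable {X : Type*} [NormedAddCommGroup X] [NormedSpace ℝ X]
variable {T G : ℝ → ℝ → X →L[ℝ] X} {B : ℝ → X →L[ℝ] X} {K α ε β ρ : ℝ}

lemma RobKern.intT (h : RobKern T G B K α ε β ρ) (y : ℝ → X)
    (hy : AEStronglyMeasurable y volume) (hb : ∃ C, ∀ τ, ‖y τ‖ ≤ C) {r τ : ℝ} (hr : r ≤ τ) :
    IntegrableOn (fun σ => T τ σ (B σ (y σ))) (Set.Ioc r τ) := by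
  have h1 := (h.integrable y hy hb τ).sub ((T τ r).integrable_comp (h.integrable y hy hb r))
  refine (h1.integrableOn (s := Set.Ioc r τ)).congr_fun (fun σ hσ => ?_) measurableSet_Ioc
  have := h.k3 r τ σ (B σ (y σ)) hr
  rw [if_pos (show r < σ ∧ σ ≤ τ from hσ)] at this
  simp only [Pi.sub_apply]
  rw [this]; abel

lemma RobKern.int_k3 [CompleteSpace X] (h : RobKern T G B K α ε β ρ) (y : ℝ → X)
    (hy : AEStronglyMeasurable y volume) (hb : ∃ C, ∀ τ, ‖y τ‖ ≤ C) {r τ : ℝ} (hr : r ≤ τ) :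
    ∫ σ, G τ σ (B σ (y σ)) = T τ r (∫ σ, G r σ (B σ (y σ))) +
      ∫ σ in r..τ, T τ σ (B σ (y σ)) := by
  rw [intervalIntegral.integral_of_le hr, ← integral_indicator measurableSet_Ioc,
    ← (T τ r).integral_comp_comm (h.integrable y hy hb r), ← integral_add
    ((T τ r).integrable_comp (h.integrable y hy hb r))
    ((integrable_indicator_iff measurableSet_Ioc).2 (h.intT y hy hb hr))]
  congr 1
  funext σ
  rw [h.k3 r τ σ _ hr]
  simp only [Set.indicator, Set.mem_Ioc]

lemma rob_meas_U (U : ℝ → ℝ → X →L[ℝ] X) (hU : IsEvolutionFamily U) (s t : ℝ) (x : X) :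
    AEStronglyMeasurable ((Set.Icc s t).indicator (fun σ => U σ s x)) volume ∧
    ∃ C, ∀ τ, ‖(Set.Icc s t).indicator (fun σ => U σ s x) τ‖ ≤ C := by
  have hc : ContinuousOn (fun σ => U σ s x) (Set.Icc s t) :=
    (hU.2.2.1 x s).mono Set.Icc_subset_Ici_self
  refine ⟨?_, ?_⟩
  · rw [aestronglyMeasurable_indicator_iff measurableSet_Icc]
    exact hc.aestronglyMeasurable measurableSet_Icc
  · obtain ⟨C, hC⟩ := isCompact_Icc.exists_bound_of_continuousOn hc
    refine ⟨max C 0, fun τ => ?_⟩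
    by_cases hτ : τ ∈ Set.Icc s t
    · rw [Set.indicator_of_mem hτ]; exact (hC τ hτ).trans (le_max_left _ _)
    · rw [Set.indicator_of_notMem hτ, norm_zero]; exact le_max_right _ _

lemma RobKern.seg [CompleteSpace X] (h : RobKern T G B K α ε β ρ) (U : ℝ → ℝ → X →L[ℝ] X)
    (hU : IsEvolutionFamily U)
    (hpert : ∀ s t : ℝ, s ≤ t → ∀ x : X,
      U t s x = T t s x + ∫ τ in s..t, T t τ (B τ (U τ s x))) (s t : ℝ) (hst : s ≤ t) (x : X) :
    RobSol G B (fun τ => G τ s x - G τ t (U t s x)) ((Set.Ico s t).indicator (fun σ => U σ s x)) := by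
  obtain ⟨m0, C, b0⟩ := rob_meas_U U hU s t x
  set y := (Set.Ico s t).indicator (fun σ => U σ s x) with hy
  have hyi : y = (Set.Ico s t).indicator ((Set.Icc s t).indicator (fun σ => U σ s x)) := by
    rw [Set.indicator_indicator, Set.inter_eq_left.2 Set.Ico_subset_Icc_self]
  have m : AEStronglyMeasurable y volume := by
    rw [hyi]; exact m0.indicator measurableSet_Ico
  have b : ∀ τ, ‖y τ‖ ≤ C := fun τ => by
    rw [hyi]; exact (norm_indicator_le_norm_self _ _).trans (b0 τ)
  refine ⟨m, ⟨C, b⟩, fun τ => ?_⟩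
  -- integrals of `T τ σ B y`
  have hint : ∀ τ, s ≤ τ → τ ≤ t →
      ∫ σ in Set.Ioc s τ, T τ σ (B σ (y σ)) = U τ s x - T τ s x := by
    intro τ h1 h2
    have := hpert s τ h1 x
    rw [intervalIntegral.integral_of_le h1] at this
    rw [this, add_sub_cancel_left]
    apply setIntegral_congr_ae measurableSet_Ioc
    filter_upwards [rob_ae_ne t] with σ hσ hm
    have : σ ∈ Set.Ico s t := ⟨hm.1.le, lt_of_le_of_ne (hm.2.trans h2) hσ⟩
    rw [hy, Set.indicator_of_mem this]
  have it := (integrable_indicator_iff measurableSet_Ioc).2 (h.intT y m ⟨C, b⟩ hst)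
  have e : ∀ᵐ σ, G τ σ (B σ (y σ)) =
      G τ t ((Set.Ioc s t).indicator (fun σ => T t σ (B σ (y σ))) σ) +
        (if τ < t then (Set.Ioc s τ).indicator (fun σ => T τ σ (B σ (y σ))) σ else 0) := by
    filter_upwards [rob_ae_ne s] with σ hσ
    by_cases hm : σ ∈ Set.Ico s t
    · have hsσ : s < σ := lt_of_le_of_ne hm.1 (Ne.symm hσ)
      rw [h.k2 τ σ t _ hm.2.le, Set.indicator_of_mem (show σ ∈ Set.Ioc s t from ⟨hsσ, hm.2.le⟩)]
      congr 1
      by_cases h1 : τ < t <;> by_cases h2 : σ ≤ τ <;>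
        simp [Set.indicator, h1, h2, hsσ]
    · have : y σ = 0 := Set.indicator_of_notMem hm _
      simp [Set.indicator, this]
  rw [integral_congr_ae e]
  by_cases h1 : τ < t
  · simp only [h1, if_true]
    by_cases h2 : s ≤ τ
    · have it2 := (integrable_indicator_iff measurableSet_Ioc).2 (h.intT y m ⟨C, b⟩ h2)
      rw [integral_add ((G τ t).integrable_comp it) it2,
        (G τ t).integral_comp_comm it, integral_indicator measurableSet_Ioc,
        integral_indicator measurableSet_Ioc, hint t hst le_rfl, hint τ h2 h1.le,
        h.k2 τ s t x hst, if_pos ⟨h2, h1⟩, hy,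
        Set.indicator_of_mem (show τ ∈ Set.Ico s t from ⟨h2, h1⟩), map_sub]
      abel
    · have h2' := not_le.1 h2
      simp only [Set.Ioc_eq_empty (not_lt.2 h2'.le), Set.indicator_empty, add_zero]
      rw [(G τ t).integral_comp_comm it, integral_indicator measurableSet_Ioc, hint t hst le_rfl,
        h.k2 τ s t x hst, if_neg (fun a => h2 a.1), hy,
        Set.indicator_of_notMem (fun a => h2 a.1), map_sub]
      abel
  · simp only [h1, if_false, add_zero]
    rw [(G τ t).integral_comp_comm it, integral_indicator measurableSet_Ioc, hint t hst le_rfl,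
        h.k2 τ s t x hst, if_neg (fun a => h1 a.2), hy,
        Set.indicator_of_notMem (fun a => h1 a.2), map_sub]
    abel

lemma RobKern.cut [CompleteSpace X] (h : RobKern T G B K α ε β ρ) (s r : ℝ) (x : X) (z : ℝ → X)
    (hz : RobSol G B (fun τ => G τ s x) z) :
    RobSol G B (fun τ => G τ r (z r) + if r < s then G τ s x else 0)
      ((Set.Ici r).indicator z) := by
  obtain ⟨m, ⟨C, b⟩, e⟩ := hz
  have i := h.integrable z m ⟨C, b⟩
  refine ⟨m.indicator measurableSet_Ici, ⟨C, fun τ => (norm_indicator_le_norm_self _ _).trans (b τ)⟩,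
    fun τ => ?_⟩
  have e1 : ∀ᵐ σ, G τ σ (B σ ((Set.Ici r).indicator z σ)) =
      (if r ≤ τ then G τ σ (B σ (z σ)) else 0) - G τ r (G r σ (B σ (z σ))) := by
    filter_upwards [rob_ae_ne r] with σ hσ
    rw [h.k1 τ r σ]
    by_cases hr : r < σ
    · rw [Set.indicator_of_mem (show σ ∈ Set.Ici r from hr.le), if_pos hr]; abel
    · have : σ ∉ Set.Ici r := fun a => hr (lt_of_le_of_ne a (Ne.symm hσ))
      rw [Set.indicator_of_notMem this, if_neg hr]; simp
  have e2 : ∀ τ, ∫ σ, G τ σ (B σ (z σ)) = z τ - G τ s x := fun τ => by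
    rw [eq_sub_iff_add_eq, add_comm]; exact (e τ).symm
  have k := h.k1 τ r s x
  rw [integral_congr_ae e1]
  by_cases hr : r ≤ τ
  · simp only [hr, if_true] at k ⊢
    rw [integral_sub (i τ) ((G τ r).integrable_comp (i r)), (G τ r).integral_comp_comm (i r), e2, e2,
      map_sub, k, Set.indicator_of_mem (show τ ∈ Set.Ici r from hr)]
    abel
  · simp only [hr, if_false, zero_sub] at k ⊢
    rw [integral_neg, (G τ r).integral_comp_comm (i r), e2,
      map_sub, k, Set.indicator_of_notMem (show τ ∉ Set.Ici r from hr)]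
    abel

lemma rob_gronwall (r t L D : ℝ) (hrt : r ≤ t) (hL : 0 < L) (d : ℝ → X)
    (hD : ∀ τ ∈ Set.Icc r t, ‖d τ‖ ≤ D)
    (hTL : ∀ σ τ, r ≤ σ → σ ≤ τ → τ ≤ t → ∀ x, ‖T τ σ (B σ x)‖ ≤ L * ‖x‖)
    (hd : ∀ τ ∈ Set.Icc r t, d τ = ∫ σ in r..τ, T τ σ (B σ (d σ))) :
    ∀ τ ∈ Set.Icc r t, d τ = 0 := by
  have hD0 : 0 ≤ D := (norm_nonneg _).trans (hD r ⟨le_rfl, hrt⟩)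
  have hn : ∀ n : ℕ, ∀ τ ∈ Set.Icc r t,
      ‖d τ‖ ≤ D * (1 / 2) ^ n * Real.exp (2 * L * (τ - r)) := by
    intro n
    induction n with
    | zero =>
      intro τ hτ
      refine (hD τ hτ).trans ?_
      have : 1 ≤ Real.exp (2 * L * (τ - r)) := by
        apply Real.one_le_exp
        have := hτ.1
        have : 0 ≤ τ - r := by linarith
        positivity
      simp only [pow_zero, mul_one]
      nlinarith
    | succ n ih =>
      intro τ hτ
      rw [hd τ hτ]
      have hc : Continuous (fun σ => L * (D * (1 / 2) ^ n * Real.exp (2 * L * (σ - r)))) := by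
        fun_prop
      have := intervalIntegral.norm_integral_le_of_norm_le (μ := volume) hτ.1
        (f := fun σ => T τ σ (B σ (d σ)))
        (g := fun σ => L * (D * (1 / 2) ^ n * Real.exp (2 * L * (σ - r))))
        (Filter.Eventually.of_forall fun σ hσ => (hTL σ τ hσ.1.le hσ.2 hτ.2 _).trans
          (mul_le_mul_of_nonneg_left (ih σ ⟨hσ.1.le, hσ.2.trans hτ.2⟩) hL.le))
        (hc.intervalIntegrable _ _)
      refine this.trans ?_
      have hder : ∀ σ ∈ Set.uIcc r τ, HasDerivAt
          (fun σ => D * (1 / 2) ^ (n + 1) * Real.exp (2 * L * (σ - r)))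
          (L * (D * (1 / 2) ^ n * Real.exp (2 * L * (σ - r)))) σ := by
        intro σ _
        have h1 : HasDerivAt (fun σ : ℝ => 2 * L * (σ - r)) (2 * L * 1) σ :=
          ((hasDerivAt_id σ).sub_const r).const_mul _
        have h2 := h1.exp.const_mul (D * (1 / 2) ^ (n + 1))
        refine h2.congr_deriv ?_
        rw [pow_succ]; ring
      rw [intervalIntegral.integral_eq_sub_of_hasDerivAt hder (hc.intervalIntegrable _ _)]
      have : 0 ≤ D * (1 / 2) ^ (n + 1) * Real.exp (2 * L * (r - r)) := by positivity
      linarith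
  intro τ hτ
  have ht : Filter.Tendsto (fun n : ℕ => D * (1 / 2 : ℝ) ^ n * Real.exp (2 * L * (τ - r)))
      Filter.atTop (nhds (D * 0 * Real.exp (2 * L * (τ - r)))) :=
    ((tendsto_pow_atTop_nhds_zero_of_lt_one (by norm_num) (by norm_num)).const_mul D).mul_const _
  have := ge_of_tendsto' ht (fun n => hn n τ hτ)
  rw [mul_zero, zero_mul] at this
  exact norm_le_zero_iff.1 this

lemma RobKern.locbd [CompleteSpace X] (h : RobKern T G B K α ε β ρ) (hT : IsEvolutionFamily T)
    (r t : ℝ) : ∃ L, 0 < L ∧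
    ∀ σ τ, r ≤ σ → σ ≤ τ → τ ≤ t → ∀ x, ‖T τ σ (B σ x)‖ ≤ L * ‖x‖ := by
  have hK := h.K0
  obtain ⟨C, hC⟩ := banach_steinhaus (g := fun σ : Set.Icc r t => T t σ) (fun x => by
    obtain ⟨C, hC⟩ := isCompact_Icc.exists_bound_of_continuousOn
      (((hT.2.2.2 x t).mono (Set.Icc_subset_Iic_self (a := r))))
    exact ⟨C, fun i => hC i i.2⟩)
  obtain ⟨C2, hC2⟩ := isCompact_Icc.exists_bound_of_continuousOn
    (h.Bc.continuousOn (s := Set.Icc r t))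
  obtain ⟨C3, hC3⟩ := isCompact_Icc.exists_bound_of_continuousOn
    ((show Continuous (fun σ : ℝ => K * Real.exp (ε * |σ|)) by fun_prop).continuousOn
      (s := Set.Icc r t))
  have hG : ∀ τ σ, σ ∈ Set.Icc r t → ‖G τ σ‖ ≤ |C3| := by
    intro τ σ hσ
    refine (h.bd τ σ).trans (le_trans ?_ ((hC3 σ hσ).trans (le_abs_self _)))
    rw [Real.norm_of_nonneg (by positivity)]
    gcongr
    have := abs_nonneg (τ - σ)
    have := h.α0
    nlinarith
  refine ⟨(|C3| + |C3| * |C| + |C|) * |C2| + 1, by positivity, ?_⟩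
  intro σ τ h1 h2 h3 x
  have hσ : σ ∈ Set.Icc r t := ⟨h1, h2.trans h3⟩
  have ht : t ∈ Set.Icc r t := ⟨h1.trans (h2.trans h3), le_rfl⟩
  have cT : ‖T t σ‖ ≤ |C| := (hC ⟨σ, hσ⟩).trans (le_abs_self _)
  have key : ∀ w, ‖T τ σ w‖ ≤ (|C3| + |C3| * |C| + |C|) * ‖w‖ := by
    intro w
    have hw := norm_nonneg w
    have q1 := abs_nonneg C
    have q3 := abs_nonneg C3
    have n1 : ‖T t σ w‖ ≤ |C| * ‖w‖ := (T t σ).le_of_opNorm_le cT w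
    rcases h3.lt_or_eq with h4 | h4
    · have k := h.k2 τ σ t w (h2.trans h3)
      rw [if_pos ⟨h2, h4⟩] at k
      have k' : T τ σ w = G τ σ w - G τ t (T t σ w) := by rw [k]; abel
      rw [k']
      have n2 : ‖G τ σ w‖ ≤ |C3| * ‖w‖ := (G τ σ).le_of_opNorm_le (hG τ σ hσ) w
      have n3 : ‖G τ t (T t σ w)‖ ≤ |C3| * (|C| * ‖w‖) :=
        ((G τ t).le_of_opNorm_le (hG τ t ht) _).trans (by gcongr)
      have := norm_sub_le (G τ σ w) (G τ t (T t σ w))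
      have : 0 ≤ |C| * ‖w‖ := by positivity
      nlinarith
    · subst h4
      have : 0 ≤ |C3| * ‖w‖ := by positivity
      have : 0 ≤ |C3| * |C| * ‖w‖ := by positivity
      nlinarith
  refine (key _).trans ?_
  have n4 : ‖B σ x‖ ≤ |C2| * ‖x‖ :=
    (B σ).le_of_opNorm_le ((hC2 σ hσ).trans (le_abs_self _)) x
  calc _ ≤ (|C3| + |C3| * |C| + |C|) * (|C2| * ‖x‖) := by gcongr
    _ ≤ _ := by have := norm_nonneg x; nlinarith

lemma RobKern.traj [CompleteSpace X] (h : RobKern T G B K α ε β ρ) (hT : IsEvolutionFamily T)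
    (U : ℝ → ℝ → X →L[ℝ] X) (hU : IsEvolutionFamily U)
    (hpert : ∀ s t : ℝ, s ≤ t → ∀ x : X,
      U t s x = T t s x + ∫ τ in s..t, T t τ (B τ (U τ s x))) (r t : ℝ) (hrt : r ≤ t) (y : ℝ → X)
    (m : AEStronglyMeasurable y volume) (b : ∃ C, ∀ τ, ‖y τ‖ ≤ C)
    (hy : ∀ τ ∈ Set.Icc r t, y τ = T τ r (y r) + ∫ σ in r..τ, T τ σ (B σ (y σ))) :
    y t = U t r (y r) := by
  obtain ⟨m0, b0⟩ := rob_meas_U U hU r t (y r)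
  set u := (Set.Icc r t).indicator (fun σ => U σ r (y r)) with hu
  have huU : ∀ τ ∈ Set.Icc r t, u τ = U τ r (y r) := fun τ hτ => Set.indicator_of_mem hτ _
  obtain ⟨L, hL, hTL⟩ := h.locbd hT r t
  have hd : ∀ τ ∈ Set.Icc r t, y τ - u τ = ∫ σ in r..τ, T τ σ (B σ (y σ - u σ)) := by
    intro τ hτ
    have i1 := h.intT y m b hτ.1
    have i2 := h.intT u m0 b0 hτ.1
    simp only [map_sub]
    rw [intervalIntegral.integral_sub ((intervalIntegrable_iff_integrableOn_Ioc_of_le hτ.1).2 i1)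
      ((intervalIntegrable_iff_integrableOn_Ioc_of_le hτ.1).2 i2)]
    have e : ∫ σ in r..τ, T τ σ (B σ (u σ)) = ∫ σ in r..τ, T τ σ (B σ (U σ r (y r))) := by
      apply intervalIntegral.integral_congr
      intro σ hσ
      rw [Set.uIcc_of_le hτ.1] at hσ
      simp only [huU σ ⟨hσ.1, hσ.2.trans hτ.2⟩]
    have e1 := hy τ hτ
    have e2 := hpert r τ hτ.1 (y r)
    rw [e, huU τ hτ, e2]
    nth_rewrite 1 [e1]
    abel
  obtain ⟨C1, hC1⟩ := b
  obtain ⟨C2, hC2⟩ := b0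
  have := rob_gronwall r t L (C1 + C2) hrt hL (fun τ => y τ - u τ)
    (fun τ _ => (norm_sub_le _ _).trans (add_le_add (hC1 τ) (hC2 τ))) hTL hd t ⟨hrt, le_rfl⟩
  rw [← huU t ⟨hrt, le_rfl⟩]
  exact sub_eq_zero.1 this
end
/-- Robustness theorem: if `T` admits a nonuniform exponential dichotomy
with constants `K, α > 0`, `ε ≥ 0`, `U(t,s) = T(t,s) + ∫_s^t T(t,τ)B(τ)U(τ,s) dτ`, and
`q = 2K sup_t ∫ e^{-α|t-s|} ‖B(s)‖ e^{ε|s|} ds < 1`, then `U` also admits a nonuniform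
exponential dichotomy. -/
theorem robustness_of_NED {X : Type*} [NormedAddCommGroup X] [NormedSpace ℝ X]
    [CompleteSpace X]
    (T U : ℝ → ℝ → X →L[ℝ] X)
    (hT : IsEvolutionFamily T) (hU : IsEvolutionFamily U)
    (P : ℝ → X →L[ℝ] X) (S : ℝ → ℝ → X →L[ℝ] X) (K α ε : ℝ)
    (hned : HasNEDWith T P S K α ε)
    (B : ℝ → X →L[ℝ] X) (hB : Continuous B)
    (hpert : ∀ s t : ℝ, s ≤ t → ∀ x : X,
      U t s x = T t s x + ∫ τ in s..t, T t τ (B τ (U τ s x)))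
    (hBint : ∀ t : ℝ,
      Integrable (fun s => Real.exp (-α * |t - s|) * (‖B s‖ * Real.exp (ε * |s|))))
    (q : ℝ) (hq1 : q < 1)
    (hq : ∀ t : ℝ,
      2 * K * ∫ s, Real.exp (-α * |t - s|) * (‖B s‖ * Real.exp (ε * |s|)) ≤ q) :
    HasNED U := by
  obtain ⟨β, ρ, h⟩ := rob_kern T hT P S K α ε hned B hB hBint q hq1 hq
  generalize robG T P S = G at h
  obtain ⟨H, hH, hHb⟩ := h.green
  have hK := h.K0
  have hρ : 0 < 1 - ρ := sub_pos.2 h.ρ1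
  have U1 : ∀ t x, U t t x = x := fun t x => by rw [hU.1]; rfl
  have F1 : ∀ s t, s ≤ t → ∀ x τ, H τ s x - H τ t (U t s x) =
      (Set.Ico s t).indicator (fun σ => U σ s x) τ := by
    intro s t hst x τ
    exact h.sol_unique (h.sol_sub (hH s x) (hH t (U t s x))) (h.seg U hU hpert s t hst x) τ
  have F2 : ∀ r s x τ, (Set.Ici r).indicator (fun τ => H τ s x) τ =
      H τ r (H r s x) + if r < s then H τ s x else 0 := by
    intro r s x τ
    have c := h.cut s r x _ (hH s x)
    by_cases hr : r < s
    · simp only [hr, if_true] at c ⊢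
      exact h.sol_unique c (h.sol_add (hH r (H r s x)) (hH s x)) τ
    · simp only [hr, if_false, add_zero] at c ⊢
      exact h.sol_unique c (hH r (H r s x)) τ
  have F3 : ∀ s t, s ≤ t → ∀ x, H t s x = U t s (H s s x) := by
    intro s t hst x
    obtain ⟨m, b, e⟩ := hH s x
    refine h.traj hT U hU hpert s t hst (fun τ => H τ s x) m b fun τ hτ => ?_
    have k := h.k3 s τ s x hτ.1
    rw [if_neg (fun a => lt_irrefl _ a.1), add_zero] at k
    have e1 := e τ
    have e2 := e s
    simp only at e1 e2 ⊢
    rw [h.int_k3 _ m b hτ.1, k, ← add_assoc, ← map_add, ← e2] at e1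
    exact e1
  have F4 : ∀ r s, r < s → ∀ x, U s r (H r s x) = H s s x - x := by
    intro r s hrs x
    obtain ⟨m, b, e⟩ := hH s x
    have hae : (fun τ => H τ s x) =ᵐ[volume] (fun τ => H τ s x - if τ = s then x else 0) := by
      filter_upwards [rob_ae_ne s] with τ hτ
      rw [if_neg hτ, sub_zero]
    have := h.traj hT U hU hpert r s hrs.le (fun τ => H τ s x - if τ = s then x else 0)
      (m.congr hae) ?_ ?_
    · simpa [hrs.ne] using this.symm
    · obtain ⟨C, hC⟩ := b
      refine ⟨C + ‖x‖, fun τ => (norm_sub_le _ _).trans (add_le_add (hC τ) ?_)⟩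
      split_ifs <;> simp
    · intro τ hτ
      have k := h.k3 r τ s x hτ.1
      have e1 := e τ
      have e2 := e r
      have e3 : ∫ σ in r..τ, T τ σ (B σ (H σ s x - if σ = s then x else 0)) =
          ∫ σ in r..τ, T τ σ (B σ (H σ s x)) := by
        apply intervalIntegral.integral_congr_ae
        filter_upwards [hae] with σ hσ _
        rw [← hσ]
      have e4 : (if r < s ∧ s ≤ τ then T τ s x else 0) = if τ = s then x else 0 := by
        by_cases hs : τ = s
        · subst hs
          rw [if_pos ⟨hrs, le_rfl⟩, if_pos rfl, hT.1]; rfl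
        · rw [if_neg hs, if_neg (fun a => hs (le_antisymm hτ.2 a.2))]
      simp only at e1 e2 ⊢
      rw [e3, if_neg hrs.ne, sub_zero, e2, map_add, e1, k, e4, h.int_k3 _ m b hτ.1]
      abel
  have PP : ∀ s x, H s s (H s s x) = H s s x := by
    intro s x
    have := F2 s s x s
    rw [Set.indicator_of_mem (Set.self_mem_Ici (a := s)), if_neg (lt_irrefl _), add_zero] at this
    exact this.symm
  refine ⟨fun s => H s s, fun t s => if t < s then -(H t s) else 1 - H s s, 1 + K / (1 - ρ), β, ε,
    by positivity, h.β0, h.ε0, ?_, ?_, ?_, ?_, ?_, ?_, ?_, ?_⟩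
  · intro t; ext x; exact PP t x
  · intro s t hst
    ext x
    have := F1 s t hst x t
    rw [Set.indicator_of_notMem (fun a => lt_irrefl _ a.2), sub_eq_zero, F3 s t hst] at this
    exact this
  · intro t s hts
    ext x
    rcases hts.lt_or_eq with hl | rfl
    · simp only [if_pos hl, ContinuousLinearMap.comp_apply, neg_apply, map_neg,
        F4 t s hl x]
      simp
    · simp [U1]
  · intro t s hts
    ext x
    rcases hts.lt_or_eq with hl | rfl
    · have := F1 t s hts (x - H t t x) t
      rw [Set.indicator_of_mem (show t ∈ Set.Ico t s from ⟨le_rfl, hl⟩), U1, map_sub (H t t), PP,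
        sub_self, zero_sub] at this
      simpa [hl, neg_add_eq_sub] using this
    · simp [U1, PP]
  · intro t s hts
    ext x
    rcases hts.lt_or_eq with hl | rfl
    · have := F2 s s x t
      rw [Set.indicator_of_notMem (show t ∉ Set.Ici s from not_le.2 hl), if_neg (lt_irrefl _),
        add_zero] at this
      simp [hl, ← this]
    · simp [PP]
  · intro t s hts
    ext x
    rcases hts.lt_or_eq with hl | rfl
    · have := F2 t s x t
      rw [Set.indicator_of_mem (Set.self_mem_Ici (a := t)), if_pos hl] at this
      simpa [hl] using this
    · simp [PP]
  · intro s t hst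
    have e : (U t s).comp (H s s) = H t s := by
      ext x; exact (F3 s t hst x).symm
    rw [e]
    refine (hHb t s).trans ?_
    rw [abs_of_nonneg (sub_nonneg.2 hst)]
    gcongr
    linarith
  · intro t s hts
    rcases hts.lt_or_eq with hl | rfl
    · simp only [if_pos hl, norm_neg]
      refine (hHb t s).trans ?_
      rw [abs_sub_comm, abs_of_nonneg (sub_nonneg.2 hts)]
      gcongr
      linarith
    · simp only [lt_irrefl, if_false]
      have h1 := hHb t t
      simp only [sub_self, abs_zero, mul_zero, zero_add] at h1 ⊢
      have h2 : ‖(1 : X →L[ℝ] X)‖ ≤ 1 := ContinuousLinearMap.norm_id_le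
      have h3 : 1 ≤ Real.exp (ε * |t|) := Real.one_le_exp (mul_nonneg h.ε0 (abs_nonneg _))
      refine (norm_sub_le _ _).trans ?_
      linarith
end

section
/- If x ∈ Č satisfies the variation-of-constants equation x(t) = U(t,s)x(s) + ∫_s^t U(t,τ)y(τ) dτ for all t ≥ s, where U(t,s) = T(t,s) + ∫_s^t T(t,τ)B(τ)U(τ,s) dτ, then x satisfies x(t) = T(t,s)x(s) + ∫_s^t T(t,τ)(y(τ) + B(τ)x(τ)) dτ for all t ≥ s; that is, in the operator notation of the paper, Rx = y + B(·)x(·) whenever Sx = y. -/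
open Real MeasureTheory

lemma aux_li {X : Type*} [NormedAddCommGroup X] {f : ℝ → X}
    (hf : LocallyIntegrable f volume) (a b : ℝ) : IntervalIntegrable f volume a b :=
  (hf.integrableOn_isCompact isCompact_uIcc).intervalIntegrable

lemma aux_lin {X : Type*} [NormedAddCommGroup X] {f : ℝ → X}
    (hf : LocallyIntegrable f volume) : LocallyIntegrable (fun τ => ‖f τ‖) volume :=
  fun x => by
    obtain ⟨s, hs, h⟩ := hf x
    exact ⟨s, hs, h.norm⟩

lemma aux_partition (F : Set ℝ) (a b : ℝ) (hab : a ≤ b) (hF : F ⊆ Set.Icc a b) (f g : ℝ → ℝ)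
    (hg : LocallyIntegrable g volume) (hg0 : ∀ x, 0 ≤ g x) (δ : ℝ) (hδ : 0 < δ)
    (h : ∀ s ∈ F, ∀ r ∈ F, s ≤ r → r - s ≤ δ → |f r - f s| ≤ ∫ τ in s..r, g τ) :
    volume (f '' F) ≤ ENNReal.ofReal (∫ τ in a..b, g τ) := by
  have hgi : ∀ u v, IntervalIntegrable g volume u v := fun u v => aux_li hg u v
  obtain ⟨N, hN⟩ := exists_nat_gt ((b - a) / δ)
  have hN0 : (0 : ℝ) < N := lt_of_le_of_lt (div_nonneg (by linarith) hδ.le) hN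
  set p : ℕ → ℝ := fun j => a + j * ((b - a) / N) with hp
  have hstep : (b - a) / N ≤ δ := by
    rw [div_le_iff₀ hN0]; rw [div_lt_iff₀ hδ] at hN; linarith
  have hst0 : 0 ≤ (b - a) / N := div_nonneg (by linarith) hN0.le
  have hpd : ∀ j, p (j + 1) - p j = (b - a) / N := by
    intro j; simp only [hp]; push_cast; ring
  have hcov : f '' F ⊆ ⋃ j ∈ Finset.range N, f '' (F ∩ Set.Icc (p j) (p (j + 1))) := by
    rintro _ ⟨z, hz, rfl⟩
    have hzz := hF hz
    have : ∀ n : ℕ, p 0 ≤ z → z ≤ p n → 0 < n → ∃ j < n, z ∈ Set.Icc (p j) (p (j + 1)) := by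
      intro n
      induction n with
      | zero => intro _ _ h; omega
      | succ n ih =>
        intro h0 h1 _
        by_cases hc : p n ≤ z
        · exact ⟨n, by omega, hc, h1⟩
        · rcases Nat.eq_zero_or_pos n with rfl | hn
          · exact absurd h0 hc
          · obtain ⟨j, hj, hj'⟩ := ih h0 (not_le.1 hc).le hn
            exact ⟨j, by omega, hj'⟩
    obtain ⟨j, hj, hj'⟩ := this N (by simp [hp, hzz.1])
      (by simp only [hp]; rw [mul_div_cancel₀ _ hN0.ne']; linarith [hzz.2]) (by exact_mod_cast hN0)
    simp only [Set.mem_iUnion]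
    exact ⟨j, Finset.mem_range.2 hj, z, ⟨hz, hj'⟩, rfl⟩
  have hpiece : ∀ j, volume (f '' (F ∩ Set.Icc (p j) (p (j + 1)))) ≤
      ENNReal.ofReal (∫ τ in p j..p (j + 1), g τ) := by
    intro j
    refine (Real.volume_le_diam _).trans (Metric.ediam_le ?_)
    have key : ∀ s ∈ F ∩ Set.Icc (p j) (p (j + 1)), ∀ r ∈ F ∩ Set.Icc (p j) (p (j + 1)), s ≤ r →
        edist (f r) (f s) ≤ ENNReal.ofReal (∫ τ in p j..p (j + 1), g τ) := by
      intro s hs r hr hsr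
      rw [edist_dist, Real.dist_eq]
      apply ENNReal.ofReal_le_ofReal
      refine (h s hs.1 r hr.1 hsr ?_).trans ?_
      · linarith [hpd j, hs.2.1, hr.2.2]
      · exact intervalIntegral.integral_mono_interval hs.2.1 hsr hr.2.2
          (Filter.Eventually.of_forall hg0) (hgi _ _)
    rintro _ ⟨s, hs, rfl⟩ _ ⟨r, hr, rfl⟩
    rcases le_total s r with hsr | hsr
    · rw [edist_comm]; exact key s hs r hr hsr
    · exact key r hr s hs hsr
  calc volume (f '' F) ≤ _ := measure_mono hcov
    _ ≤ _ := measure_biUnion_finset_le _ _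
    _ ≤ ∑ j ∈ Finset.range N, ENNReal.ofReal (∫ τ in p j..p (j + 1), g τ) :=
        Finset.sum_le_sum fun j _ => hpiece j
    _ = ENNReal.ofReal (∑ j ∈ Finset.range N, ∫ τ in p j..p (j + 1), g τ) := by
        rw [ENNReal.ofReal_sum_of_nonneg]
        intro j _
        exact intervalIntegral.integral_nonneg (by linarith [hpd j]) (fun u _ => hg0 u)
    _ = _ := by
        rw [intervalIntegral.sum_integral_adjacent_intervals (fun k _ => hgi _ _)]
        congr 2
        · simp [hp]
        · simp only [hp]; rw [mul_div_cancel₀ _ hN0.ne']; ring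

lemma aux_null (F : Set ℝ) (hFc : IsClosed F) (a b : ℝ) (hab : a ≤ b) (hF : F ⊆ Set.Icc a b)
    (f h : ℝ → ℝ) (hh : LocallyIntegrable h volume) (hh0 : ∀ x, 0 ≤ h x) (C : ℝ) (hC : 0 ≤ C)
    (hf : ∀ s ∈ F, ∀ r ∈ F, s ≤ r →
      |f r - f s| ≤ C * ((r - s) * (∫ τ in s..r, h τ) + ∫ τ in s..r, Fᶜ.indicator h τ)) :
    volume (f '' F) = 0 := by
  set δ : ℕ → ℝ := fun n => 1 / ((n : ℝ) + 1) with hδ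
  have hδ0 : ∀ n, 0 < δ n := fun n => by positivity
  have hδ1 : ∀ n, δ n ≤ 1 := fun n => by
    simp only [hδ]; rw [div_le_one (by positivity)]; linarith [Nat.cast_nonneg (α := ℝ) n]
  have hδt : Filter.Tendsto δ Filter.atTop (nhds 0) := tendsto_one_div_add_atTop_nhds_zero_nat
  set E : ℕ → Set ℝ := fun n => Fᶜ ∩ Metric.cthickening (δ n) F with hE
  have hEm : ∀ n, MeasurableSet (E n) := fun n =>
    hFc.measurableSet.compl.inter Metric.isClosed_cthickening.measurableSet
  set g : ℕ → ℝ → ℝ := fun n τ => C * (δ n * h τ + (E n).indicator h τ) with hg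
  have hind0 : ∀ (S : Set ℝ) x, 0 ≤ S.indicator h x := fun S x => Set.indicator_nonneg (fun y _ => hh0 y) x
  have hgl : ∀ n, LocallyIntegrable (g n) volume := fun n =>
    (((hh.smul (δ n)).add (hh.indicator (hEm n))).smul C)
  have hvol : ∀ n, volume (f '' F) ≤ ENNReal.ofReal (∫ τ in a..b, g n τ) := by
    intro n
    refine aux_partition F a b hab hF f (g n) (hgl n) ?_ (δ n) (hδ0 n) ?_
    · intro x
      have := hind0 (E n) x
      have := hh0 x
      have := (hδ0 n).le
      simp only [hg]; positivity
    · intro s hs r hr hsr hd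
      refine (hf s hs r hr hsr).trans ?_
      simp only [hg]
      rw [intervalIntegral.integral_const_mul, intervalIntegral.integral_add, intervalIntegral.integral_const_mul]
      · have h1 : 0 ≤ ∫ τ in s..r, h τ := intervalIntegral.integral_nonneg hsr (fun u _ => hh0 u)
        have h2 : ∫ τ in s..r, Fᶜ.indicator h τ = ∫ τ in s..r, (E n).indicator h τ := by
          apply intervalIntegral.integral_congr
          intro τ hτ
          rw [Set.uIcc_of_le hsr] at hτ
          have : τ ∈ Metric.cthickening (δ n) F := by
            apply Metric.mem_cthickening_of_dist_le τ s _ _ hs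
            rw [Real.dist_eq, abs_of_nonneg (by linarith [hτ.1])]; linarith [hτ.2]
          by_cases hτF : τ ∈ F <;> simp [Set.indicator, hE, this, hτF]
        rw [h2]
        gcongr
      · exact aux_li (hh.smul (δ n)) _ _
      · exact aux_li (hh.indicator (hEm n)) _ _
  have hlim : Filter.Tendsto (fun n => ∫ τ in a..b, g n τ) Filter.atTop (nhds (∫ τ in a..b, (0:ℝ))) := by
    refine intervalIntegral.tendsto_integral_filter_of_dominated_convergence (fun τ => C * (h τ + h τ)) ?_ ?_ ?_ ?_
    · exact Filter.Eventually.of_forall fun n => (hgl n).aestronglyMeasurable.restrict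
    · refine Filter.Eventually.of_forall fun n => Filter.Eventually.of_forall fun x _ => ?_
      have h1 := hind0 (E n) x
      have h2 := hh0 x
      have h3 := (hδ0 n).le
      have h4 : (E n).indicator h x ≤ h x := Set.indicator_le_self' (fun _ _ => h2) x
      have h5 : δ n * h x ≤ h x := mul_le_of_le_one_left h2 (hδ1 n)
      simp only [hg]
      rw [Real.norm_of_nonneg (by positivity)]
      gcongr
    · exact aux_li ((hh.add hh).smul C) _ _
    · refine Filter.Eventually.of_forall fun x _ => ?_
      have h1 : Filter.Tendsto (fun n => (E n).indicator h x) Filter.atTop (nhds 0) := by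
        apply tendsto_const_nhds.congr'
        by_cases hx : x ∈ F
        · exact Filter.Eventually.of_forall fun n => by simp [Set.indicator, hE, hx]
        · have : 0 < Metric.infEDist x F := by
            rw [pos_iff_ne_zero]; intro h0
            exact hx (hFc.closure_eq ▸ Metric.mem_closure_iff_infEDist_zero.2 h0)
          have ht : Filter.Tendsto (fun n => ENNReal.ofReal (δ n)) Filter.atTop (nhds 0) := by
            simpa using ENNReal.tendsto_ofReal hδt
          filter_upwards [ht.eventually (gt_mem_nhds this)] with n hn
          have : x ∉ Metric.cthickening (δ n) F := by
            rw [Metric.mem_cthickening_iff]; exact not_le.2 hn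
          simp [Set.indicator, hE, this]
      have := ((hδt.mul_const (h x)).add h1).const_mul C
      simpa [hg] using this
  have hlim' : Filter.Tendsto (fun n => ENNReal.ofReal (∫ τ in a..b, g n τ)) Filter.atTop (nhds 0) := by
    simpa using ENNReal.tendsto_ofReal hlim
  exact le_antisymm (ge_of_tendsto' hlim' hvol) (by simp)

lemma aux_const (a b : ℝ) (hab : a ≤ b) (f : ℝ → ℝ) (hf : ContinuousOn f (Set.Icc a b))
    (F : ℕ → Set ℝ) (hcov : ∀ s ∈ Set.Icc a b, ∃ k, s ∈ F k)
    (hnull : ∀ k, volume (f '' F k) = 0) : f a = f b := by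
  by_contra hne
  have h1 := intermediate_value_uIcc (f := f) (a := a) (b := b) (by rwa [Set.uIcc_of_le hab])
  have h2 : Set.uIcc (f a) (f b) ⊆ ⋃ k, f '' F k := by
    refine h1.trans ?_
    rintro _ ⟨z, hz, rfl⟩
    rw [Set.uIcc_of_le hab] at hz
    obtain ⟨k, hk⟩ := hcov z hz
    exact Set.mem_iUnion.2 ⟨k, z, hk, rfl⟩
  have h3 : volume (Set.uIcc (f a) (f b)) = 0 :=
    measure_mono_null h2 (measure_iUnion_null hnull)
  rw [Real.volume_interval, ENNReal.ofReal_eq_zero] at h3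
  exact hne (sub_eq_zero.1 (abs_nonpos_iff.1 h3)).symm

lemma aux_joint {X : Type*} [NormedAddCommGroup X] [NormedSpace ℝ X]
    (G : ℝ → X →L[ℝ] X) (M : ℝ) (hG : ∀ v, Continuous fun τ => G τ v) (hM : ∀ τ, ‖G τ‖ ≤ M) :
    Continuous fun p : X × ℝ => G p.2 p.1 := by
  refine continuous_prod_of_continuous_lipschitzWith _ M.toNNReal (fun v => hG v) fun τ => ?_
  exact (G τ).lipschitz.weaken (by
    rw [← NNReal.coe_le_coe]; simpa using Or.inl (hM τ))

lemma aux_int {X : Type*} [NormedAddCommGroup X] [NormedSpace ℝ X]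
    (G : ℝ → X →L[ℝ] X) (M : ℝ) (hG : ∀ v, Continuous fun τ => G τ v) (hM : ∀ τ, ‖G τ‖ ≤ M)
    (a b : ℝ) (v : ℝ → X) (hv : IntervalIntegrable v volume a b) :
    IntervalIntegrable (fun τ => G τ (v τ)) volume a b := by
  have key : ∀ μ : Measure ℝ, Integrable v μ → Integrable (fun τ => G τ (v τ)) μ := by
    intro μ h
    refine (h.norm.const_mul M).mono' ?_ ?_
    · exact (aux_joint G M hG hM).comp_aestronglyMeasurable
        (h.aestronglyMeasurable.prodMk continuous_id.aestronglyMeasurable)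
    · exact Filter.Eventually.of_forall fun τ => (G τ).le_of_opNorm_le (hM τ) _
  exact ⟨key _ hv.1, key _ hv.2⟩

lemma aux_left {X : Type*} [NormedAddCommGroup X] [NormedSpace ℝ X] [CompleteSpace X]
    (V : ℝ → ℝ → X →L[ℝ] X) (hV : IsEvolutionFamily V) (a b : ℝ) (hab : a ≤ b) :
    ∃ (G : ℝ → X →L[ℝ] X) (M : ℝ), (∀ τ ∈ Set.Icc a b, G τ = V b τ) ∧
      (∀ v, Continuous fun τ => G τ v) ∧ (∀ τ, ‖G τ‖ ≤ M) := by
  have hc : ∀ v, Continuous fun τ => V b (max a (min τ b)) v := fun v =>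
    (hV.2.2.2 v b).comp_continuous (f := fun τ => max a (min τ b)) (by fun_prop)
      (fun τ => by simp [hab])
  have : ∃ M, ∀ τ, ‖V b (max a (min τ b))‖ ≤ M := by
    obtain ⟨M, hM⟩ := banach_steinhaus (g := fun τ : Set.Icc a b => V b (max a (min τ b))) (by
      intro v
      obtain ⟨C, hC⟩ := isCompact_Icc.exists_bound_of_continuousOn (hc v).continuousOn (s := Set.Icc a b)
      exact ⟨C, fun i => hC i i.2⟩)
    refine ⟨M, fun τ => ?_⟩
    have := hM ⟨max a (min τ b), by simp [hab]⟩
    simpa [hab] using this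
  obtain ⟨M, hM⟩ := this
  refine ⟨_, M, ?_, hc, hM⟩
  rintro τ ⟨h1, h2⟩
  simp [h1, h2]

lemma aux_right {X : Type*} [NormedAddCommGroup X] [NormedSpace ℝ X] [CompleteSpace X]
    (V : ℝ → ℝ → X →L[ℝ] X) (hV : IsEvolutionFamily V) (a b : ℝ) :
    ∃ M : ℝ, ∀ τ ∈ Set.Icc a b, ‖V τ a‖ ≤ M := by
  obtain ⟨M, hM⟩ := banach_steinhaus (g := fun τ : Set.Icc a b => V τ a) (by
      intro v
      obtain ⟨C, hC⟩ := isCompact_Icc.exists_bound_of_continuousOn (s := Set.Icc a b)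
        ((hV.2.2.1 v a).mono Set.Icc_subset_Ici_self)
      exact ⟨C, fun i => hC i i.2⟩)
  exact ⟨M, fun τ h => hM ⟨τ, h⟩⟩

lemma aux_sets {X : Type*} [NormedAddCommGroup X] [NormedSpace ℝ X] [CompleteSpace X]
    (V : ℝ → ℝ → X →L[ℝ] X) (hV : IsEvolutionFamily V) (a b : ℝ) :
    ∃ F : ℕ → Set ℝ, (∀ k, IsClosed (F k)) ∧ (∀ k, F k ⊆ Set.Icc a b) ∧
      (∀ s ∈ Set.Icc a b, ∃ k, s ∈ F k) ∧
      (∀ k, ∀ s ∈ F k, (∀ τ ∈ Set.Icc s b, ‖V τ s‖ ≤ k) ∧ (∀ τ ∈ Set.Icc a s, ‖V s τ‖ ≤ k)) := by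
  refine ⟨fun k => Set.Icc a b ∩ ⋂ τ ∈ Set.Icc a b, ⋂ v : X,
    {s | ‖V τ (min s τ) v‖ ≤ k * ‖v‖} ∩ {s | ‖V (max s τ) τ v‖ ≤ k * ‖v‖}, ?_, ?_, ?_, ?_⟩
  · intro k
    refine isClosed_Icc.inter (isClosed_biInter fun τ _ => isClosed_iInter fun v => IsClosed.inter ?_ ?_)
    · refine isClosed_le (Continuous.norm ?_) continuous_const
      exact (hV.2.2.2 v τ).comp_continuous (f := fun s => min s τ) (by fun_prop) (fun s => by simp)
    · refine isClosed_le (Continuous.norm ?_) continuous_const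
      exact (hV.2.2.1 v τ).comp_continuous (f := fun s => max s τ) (by fun_prop) (fun s => by simp)
  · exact fun k => Set.inter_subset_left
  · intro s hs
    obtain ⟨M₁, hM₁⟩ := aux_right V hV s b
    obtain ⟨G, M₂, hG, -, hM₂⟩ := aux_left V hV a s hs.1
    obtain ⟨k, hk⟩ := exists_nat_ge (max 1 (max M₁ M₂))
    have hk1 : (1:ℝ) ≤ k := (le_max_left _ _).trans hk
    have hk2 : M₁ ≤ k := (le_max_left _ _).trans ((le_max_right _ _).trans hk)
    have hk3 : M₂ ≤ k := (le_max_right _ _).trans ((le_max_right _ _).trans hk)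
    refine ⟨k, hs, ?_⟩
    simp only [Set.mem_iInter]
    intro τ hτ v
    have hid : ∀ t, ‖V t t v‖ ≤ k * ‖v‖ := fun t => by
      rw [hV.1]; simpa using le_mul_of_one_le_left (norm_nonneg v) hk1
    constructor
    · show ‖V τ (min s τ) v‖ ≤ k * ‖v‖
      rcases le_total s τ with h | h
      · rw [min_eq_left h]
        exact (V τ s).le_of_opNorm_le ((hM₁ τ ⟨h, hτ.2⟩).trans hk2) v
      · rw [min_eq_right h]; exact hid τ
    · show ‖V (max s τ) τ v‖ ≤ k * ‖v‖
      rcases le_total s τ with h | h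
      · rw [max_eq_right h]; exact hid τ
      · rw [max_eq_left h]
        refine (V s τ).le_of_opNorm_le (le_trans ?_ hk3) v
        rw [← hG τ ⟨hτ.1, h⟩]; exact hM₂ τ
  · rintro k s ⟨hs, h⟩
    simp only [Set.mem_iInter] at h
    constructor
    · intro τ hτ
      refine ContinuousLinearMap.opNorm_le_bound _ (Nat.cast_nonneg k) fun v => ?_
      have := (h τ ⟨hs.1.trans hτ.1, hτ.2⟩ v).1
      simpa [min_eq_left hτ.1] using this
    · intro τ hτ
      refine ContinuousLinearMap.opNorm_le_bound _ (Nat.cast_nonneg k) fun v => ?_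
      have := (h τ ⟨hτ.1, hτ.2.trans hs.2⟩ v).2
      simpa [max_eq_left hτ.2] using this

lemma aux_key {X : Type*} [NormedAddCommGroup X]
    [NormedSpace ℝ X] [CompleteSpace X]
    (T U : ℝ → ℝ → X →L[ℝ] X)
    (hT : IsEvolutionFamily T) (hU : IsEvolutionFamily U)
    (B : ℝ → X →L[ℝ] X) (hB : Continuous B)
    (hpert : ∀ s t : ℝ, s ≤ t → ∀ v : X,
      U t s v = T t s v + ∫ τ in s..t, T t τ (B τ (U τ s v)))
    (ξ r b : ℝ) (h1 : ξ ≤ r) (h2 : r ≤ b) (v : X) :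
    T b r (U r ξ v) = T b ξ v + ∫ τ in ξ..r, T b τ (B τ (U τ ξ v)) := by
  obtain ⟨G, M, hG, hGc, hGM⟩ := aux_left T hT ξ r h1
  have hBU : ContinuousOn (fun τ => B τ (U τ ξ v)) (Set.uIcc ξ r) := by
    rw [Set.uIcc_of_le h1]
    exact hB.continuousOn.clm_apply ((hU.2.2.1 v ξ).mono Set.Icc_subset_Ici_self)
  have hi : IntervalIntegrable (fun τ => T r τ (B τ (U τ ξ v))) volume ξ r := by
    refine (aux_int G M hGc hGM ξ r _ hBU.intervalIntegrable).congr ?_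
    intro τ hτ
    rw [Set.uIoc_of_le h1] at hτ
    simp only [hG τ ⟨hτ.1.le, hτ.2⟩]
  rw [hpert ξ r h1 v, map_add, ← ContinuousLinearMap.intervalIntegral_comp_comm _ hi]
  congr 1
  · rw [← hT.2.1 ξ r b h1 h2]; rfl
  · apply intervalIntegral.integral_congr
    intro τ hτ
    rw [Set.uIcc_of_le h1] at hτ
    simp only
    rw [← hT.2.1 τ r b hτ.2 h2]; rfl

lemma aux_main {X : Type*} [NormedAddCommGroup X]
    [NormedSpace ℝ X] [CompleteSpace X]
    (T U : ℝ → ℝ → X →L[ℝ] X)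
    (hT : IsEvolutionFamily T) (hU : IsEvolutionFamily U)
    (B : ℝ → X →L[ℝ] X) (hB : Continuous B)
    (hpert : ∀ s t : ℝ, s ≤ t → ∀ v : X,
      U t s v = T t s v + ∫ τ in s..t, T t τ (B τ (U τ s v)))
    (y : ℝ → X) (hy : LocallyIntegrable y volume)
    (x : ℝ → X) (hx : Continuous x)
    (hsol : ∀ s t : ℝ, s ≤ t → x t = U t s (x s) + ∫ τ in s..t, U t τ (y τ))
    (a b : ℝ)
    (G : ℝ → X →L[ℝ] X) (M : ℝ) (hG : ∀ τ ∈ Set.Icc a b, G τ = T b τ)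
    (hGc : ∀ v, Continuous fun τ => G τ v) (hGM : ∀ τ, ‖G τ‖ ≤ M)
    (F : Set ℝ) (hFm : IsClosed F) (hFab : F ⊆ Set.Icc a b) (k : ℝ) (hk : 0 ≤ k)
    (hF : ∀ s ∈ F, (∀ τ ∈ Set.Icc s b, ‖U τ s‖ ≤ k) ∧ (∀ τ ∈ Set.Icc a s, ‖U s τ‖ ≤ k)) :
    ∃ C, 0 ≤ C ∧ ∀ s ∈ F, ∀ r ∈ F, s ≤ r →
      ‖G r (x r) - G s (x s) - ∫ τ in s..r, G τ (y τ + B τ (x τ))‖ ≤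
        C * ((r - s) * (∫ τ in s..r, (1 + ‖y τ‖)) +
          ∫ τ in s..r, Fᶜ.indicator (fun τ => 1 + ‖y τ‖) τ) := by
  have hM0 : 0 ≤ M := (norm_nonneg _).trans (hGM a)
  obtain ⟨β', hβ'⟩ := isCompact_Icc.exists_bound_of_continuousOn (s := Set.Icc a b) hB.continuousOn
  obtain ⟨Z', hZ'⟩ := isCompact_Icc.exists_bound_of_continuousOn (s := Set.Icc a b) hx.continuousOn
  obtain ⟨β, hβ0, hβ⟩ : ∃ β, 0 ≤ β ∧ ∀ τ ∈ Set.Icc a b, ‖B τ‖ ≤ β :=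
    ⟨max β' 0, le_max_right _ _, fun τ h => (hβ' τ h).trans (le_max_left _ _)⟩
  obtain ⟨Z, hZ0, hZ⟩ : ∃ β, 0 ≤ β ∧ ∀ τ ∈ Set.Icc a b, ‖x τ‖ ≤ β :=
    ⟨max Z' 0, le_max_right _ _, fun τ h => (hZ' τ h).trans (le_max_left _ _)⟩
  set h : ℝ → ℝ := fun τ => 1 + ‖y τ‖ with hh
  have hh0 : ∀ τ, 0 ≤ h τ := fun τ => by simp only [hh]; positivity
  have hh1 : ∀ τ, 1 ≤ h τ := fun τ => by simp [hh]
  have hhy : ∀ τ, ‖y τ‖ ≤ h τ := fun τ => by simp [hh]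
  have hhl : LocallyIntegrable h volume := (continuous_const.locallyIntegrable).add (aux_lin hy)
  have hIl : LocallyIntegrable (Fᶜ.indicator h) volume := hhl.indicator hFm.measurableSet.compl
  have hI0 : ∀ τ, 0 ≤ Fᶜ.indicator h τ := fun τ => Set.indicator_nonneg (fun y _ => hh0 y) τ
  refine ⟨2 * (M * β * k) + (M * k + M) + M * β * (k * Z + Z), by positivity, ?_⟩
  intro s hs r hr hsr
  have hsab := hFab hs
  have hrab := hFab hr
  set H := ∫ τ in s..r, h τ with hH
  set J := ∫ τ in s..r, Fᶜ.indicator h τ with hJ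
  have hH0 : 0 ≤ H := intervalIntegral.integral_nonneg hsr (fun u _ => hh0 u)
  have hJ0 : 0 ≤ J := intervalIntegral.integral_nonneg hsr (fun u _ => hI0 u)
  -- integrability facts
  have hUs : ContinuousOn (fun τ => B τ (U τ s (x s))) (Set.uIcc s r) := by
    rw [Set.uIcc_of_le hsr]
    exact hB.continuousOn.clm_apply ((hU.2.2.1 _ s).mono Set.Icc_subset_Ici_self)
  have i1 : IntervalIntegrable (fun τ => G τ (B τ (U τ s (x s)))) volume s r :=
    aux_int G M hGc hGM _ _ _ hUs.intervalIntegrable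
  have i2 : IntervalIntegrable (fun τ => G τ (B τ (x τ))) volume s r :=
    aux_int G M hGc hGM _ _ _ ((hB.clm_apply hx).intervalIntegrable _ _)
  have i3 : IntervalIntegrable (fun τ => G τ (y τ)) volume s r :=
    aux_int G M hGc hGM _ _ _ (aux_li hy _ _)
  have i4 : IntervalIntegrable (fun τ => U r τ (y τ)) volume s r := by
    obtain ⟨G', M', hG', hGc', hGM'⟩ := aux_left U hU s r hsr
    refine (aux_int G' M' hGc' hGM' s r _ (aux_li hy _ _)).congr ?_
    intro τ hτ
    rw [Set.uIoc_of_le hsr] at hτ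
    simp only [hG' τ ⟨hτ.1.le, hτ.2⟩]
  have i5 : IntervalIntegrable (fun τ => G r (U r τ (y τ))) volume s r :=
    ⟨(G r).integrable_comp i4.1, (G r).integrable_comp i4.2⟩
  -- the key identity in terms of G
  have key : ∀ ξ ∈ Set.Icc s r, ∀ v, G r (U r ξ v) = G ξ v + ∫ τ in ξ..r, G τ (B τ (U τ ξ v)) := by
    intro ξ hξ v
    rw [hG r hrab, hG ξ ⟨hsab.1.trans hξ.1, hξ.2.trans hrab.2⟩,
      aux_key T U hT hU B hB hpert ξ r b hξ.2 hrab.2 v]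
    congr 1
    apply intervalIntegral.integral_congr
    intro τ hτ
    rw [Set.uIcc_of_le hξ.2] at hτ
    simp only [hG τ ⟨hsab.1.trans (hξ.1.trans hτ.1), hτ.2.trans hrab.2⟩]
  have hdec : G r (x r) - G s (x s) - ∫ τ in s..r, G τ (y τ + B τ (x τ)) =
      (∫ τ in s..r, (G r (U r τ (y τ)) - G τ (y τ))) +
      ∫ τ in s..r, (G τ (B τ (U τ s (x s))) - G τ (B τ (x τ))) := by
    rw [intervalIntegral.integral_sub i5 i3, intervalIntegral.integral_sub i1 i2]
    simp only [map_add]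
    rw [intervalIntegral.integral_add i3 i2, hsol s r hsr, map_add,
      key s ⟨le_rfl, hsr⟩, ContinuousLinearMap.intervalIntegral_comp_comm _ i4]
    abel
  have e1 : ‖∫ τ in s..r, (G r (U r τ (y τ)) - G τ (y τ))‖ ≤
      ∫ τ in s..r, ((M * β * k * (r - s)) * h τ + (M * k + M) * Fᶜ.indicator h τ) := by
    refine intervalIntegral.norm_integral_le_of_norm_le hsr
      (Filter.Eventually.of_forall fun ξ hξ => ?_)
      (((aux_li hhl _ _).const_mul _).add ((aux_li hIl _ _).const_mul _))
    have hξ' : ξ ∈ Set.Icc s r := ⟨hξ.1.le, hξ.2⟩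
    have hrs : 0 ≤ r - s := by linarith
    by_cases hξF : ξ ∈ F
    · have : Fᶜ.indicator h ξ = 0 := by simp [Set.indicator, hξF]
      rw [this, mul_zero, add_zero, key ξ hξ', add_sub_cancel_left]
      have := intervalIntegral.norm_integral_le_of_norm_le_const (a := ξ) (b := r)
        (f := fun τ => G τ (B τ (U τ ξ (y ξ)))) (C := M * (β * (k * ‖y ξ‖))) (by
          intro τ hτ
          rw [Set.uIoc_of_le hξ.2] at hτ
          refine (G τ).le_of_opNorm_le_of_le (hGM τ) ((B τ).le_of_opNorm_le_of_le (hβ τ ?_)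
            ((U τ ξ).le_of_opNorm_le ((hF ξ hξF).1 τ ?_) _))
          · exact ⟨by linarith [hsab.1, hξ.1, hτ.1], hτ.2.trans hrab.2⟩
          · exact ⟨hτ.1.le, hτ.2.trans hrab.2⟩)
      refine this.trans ?_
      rw [abs_of_nonneg (by linarith [hξ.2])]
      calc M * (β * (k * ‖y ξ‖)) * (r - ξ) ≤ M * (β * (k * h ξ)) * (r - s) := by
            have := hhy ξ
            have := hξ.1
            have := hξ.2
            have := hh0 ξ
            gcongr
        _ = _ := by ring
    · have : Fᶜ.indicator h ξ = h ξ := by simp [Set.indicator, hξF]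
      rw [this]
      have b1 : ‖G r (U r ξ (y ξ))‖ ≤ M * (k * ‖y ξ‖) :=
        (G r).le_of_opNorm_le_of_le (hGM r)
          ((U r ξ).le_of_opNorm_le ((hF r hr).2 ξ ⟨hsab.1.trans hξ'.1, hξ.2⟩) _)
      have b2 : ‖G ξ (y ξ)‖ ≤ M * ‖y ξ‖ := (G ξ).le_of_opNorm_le (hGM ξ) _
      have b3 : (M * k + M) * ‖y ξ‖ ≤ (M * k + M) * h ξ := by
        have := hhy ξ
        gcongr
      have b4 : 0 ≤ M * β * k * (r - s) * h ξ := by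
        have := hh0 ξ
        positivity
      have := norm_sub_le (G r (U r ξ (y ξ))) (G ξ (y ξ))
      linarith
  have e2 : ‖∫ τ in s..r, (G τ (B τ (U τ s (x s))) - G τ (B τ (x τ)))‖ ≤
      ∫ τ in s..r, (M * β * k * H + (M * β * (k * Z + Z)) * Fᶜ.indicator h τ) := by
    refine intervalIntegral.norm_integral_le_of_norm_le hsr
      (Filter.Eventually.of_forall fun τ hτ => ?_)
      (intervalIntegrable_const.add ((aux_li hIl _ _).const_mul _))
    have hτab : τ ∈ Set.Icc a b := ⟨hsab.1.trans hτ.1.le, hτ.2.trans hrab.2⟩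
    rw [← map_sub, ← map_sub]
    have b0 : ∀ c, ‖U τ s (x s) - x τ‖ ≤ c → ‖G τ (B τ (U τ s (x s) - x τ))‖ ≤ M * (β * c) :=
      fun c hc => (G τ).le_of_opNorm_le_of_le (hGM τ) ((B τ).le_of_opNorm_le_of_le (hβ τ hτab) hc)
    by_cases hτF : τ ∈ F
    · have : Fᶜ.indicator h τ = 0 := by simp [Set.indicator, hτF]
      rw [this, mul_zero, add_zero]
      refine (b0 (k * H) ?_).trans_eq (by ring)
      rw [hsol s τ hτ.1.le, sub_add_cancel_left, norm_neg]
      calc ‖∫ ξ in s..τ, U τ ξ (y ξ)‖ ≤ ∫ ξ in s..τ, k * h ξ := by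
            refine intervalIntegral.norm_integral_le_of_norm_le hτ.1.le
              (Filter.Eventually.of_forall fun ξ hξ => ?_) ((aux_li hhl _ _).const_mul _)
            exact (U τ ξ).le_of_opNorm_le_of_le
              ((hF τ hτF).2 ξ ⟨hsab.1.trans hξ.1.le, hξ.2⟩) (hhy ξ)
        _ = k * ∫ ξ in s..τ, h ξ := intervalIntegral.integral_const_mul _ _
        _ ≤ k * H := by
            gcongr
            exact intervalIntegral.integral_mono_interval le_rfl hτ.1.le hτ.2
              (Filter.Eventually.of_forall hh0) (aux_li hhl _ _)
    · have : Fᶜ.indicator h τ = h τ := by simp [Set.indicator, hτF]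
      rw [this]
      have c1 : ‖U τ s (x s)‖ ≤ k * Z :=
        (U τ s).le_of_opNorm_le_of_le ((hF s hs).1 τ ⟨hτ.1.le, hτab.2⟩) (hZ s hsab)
      have c2 := hZ τ hτab
      have c3 := b0 (k * Z + Z) ((norm_sub_le _ _).trans (add_le_add c1 c2))
      have c4 : M * β * (k * Z + Z) * 1 ≤ M * β * (k * Z + Z) * h τ := by
        have := hh1 τ
        gcongr
      have c5 : 0 ≤ M * β * k * H := by positivity
      linarith
  rw [intervalIntegral.integral_add ((aux_li hhl _ _).const_mul _) ((aux_li hIl _ _).const_mul _),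
    intervalIntegral.integral_const_mul, intervalIntegral.integral_const_mul] at e1
  rw [intervalIntegral.integral_add intervalIntegrable_const ((aux_li hIl _ _).const_mul _),
    intervalIntegral.integral_const, smul_eq_mul, intervalIntegral.integral_const_mul] at e2
  rw [hdec]
  refine (norm_add_le _ _).trans ((add_le_add e1 e2).trans ?_)
  have hrs : 0 ≤ r - s := by linarith
  have p1 : 0 ≤ (M * k + M + M * β * (k * Z + Z)) * ((r - s) * H) := by positivity
  have p2 : 0 ≤ (2 * (M * β * k)) * J := by positivity
  rw [← hH, ← hJ]
  linarith [p1, p2]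


/-- if `x` satisfies the variation-of-constants equation for the perturbed
evolution family `U` (with `U(t,s) = T(t,s) + ∫_s^t T(t,τ)B(τ)U(τ,s) dτ`), i.e.
`x(t) = U(t,s)x(s) + ∫_s^t U(t,τ)y(τ) dτ` for `t ≥ s`, then it satisfies the
variation-of-constants equation for `T` with inhomogeneity `y + B(·)x(·)`:
`x(t) = T(t,s)x(s) + ∫_s^t T(t,τ)(y(τ) + B(τ)x(τ)) dτ` for `t ≥ s`
(in the operator notation of the paper: `Sx = y` implies `Rx = y + B(·)x(·)`). -/
theorem perturbed_voc_implies_unperturbed_voc {X : Type*} [NormedAddCommGroup X]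
    [NormedSpace ℝ X] [CompleteSpace X]
    (T U : ℝ → ℝ → X →L[ℝ] X)
    (hT : IsEvolutionFamily T) (hU : IsEvolutionFamily U)
    (B : ℝ → X →L[ℝ] X) (hB : Continuous B)
    (hpert : ∀ s t : ℝ, s ≤ t → ∀ v : X,
      U t s v = T t s v + ∫ τ in s..t, T t τ (B τ (U τ s v)))
    (y : ℝ → X) (hy : LocallyIntegrable y volume)
    (x : ℝ → X) (hx : Continuous x)
    (hsol : ∀ s t : ℝ, s ≤ t → x t = U t s (x s) + ∫ τ in s..t, U t τ (y τ)) :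
    ∀ s t : ℝ, s ≤ t → x t = T t s (x s) + ∫ τ in s..t, T t τ (y τ + B τ (x τ)) := by
  intro a b hab
  obtain ⟨G, M, hG, hGc, hGM⟩ := aux_left T hT a b hab
  obtain ⟨F, hFc, hFab, hFcov, hFb⟩ := aux_sets U hU a b
  have hint : ∀ u v, IntervalIntegrable (fun τ => G τ (y τ + B τ (x τ))) volume u v := fun u v =>
    aux_int G M hGc hGM _ _ _ ((aux_li hy _ _).add ((hB.clm_apply hx).intervalIntegrable _ _))
  set w : ℝ → X := fun s => G s (x s) - ∫ τ in b..s, G τ (y τ + B τ (x τ)) with hw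
  have hwc : Continuous w :=
    ((aux_joint G M hGc hGM).comp (hx.prodMk continuous_id)).sub
      (intervalIntegral.continuous_primitive hint b)
  have hwab : w a = w b := by
    rw [SeparatingDual.eq_iff_forall_dual_eq (R := ℝ)]
    intro ψ
    refine aux_const a b hab (fun s => ψ (w s)) (ψ.continuous.comp hwc).continuousOn F hFcov ?_
    intro k
    obtain ⟨C, hC0, hC⟩ := aux_main T U hT hU B hB hpert y hy x hx hsol a b G M hG hGc hGM (F k)
      (hFc k) (hFab k) k (Nat.cast_nonneg k) (hFb k)
    refine aux_null (F k) (hFc k) a b hab (hFab k) _ (fun τ => 1 + ‖y τ‖)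
      ((continuous_const.locallyIntegrable).add (aux_lin hy)) (fun τ => by positivity) (‖ψ‖ * C)
      (by positivity) ?_
    intro s hs r hr hsr
    have h1 : w r - w s = G r (x r) - G s (x s) - ∫ τ in s..r, G τ (y τ + B τ (x τ)) := by
      simp only [hw]
      rw [← intervalIntegral.integral_interval_sub_left (hint b r) (hint b s)]
      abel
    rw [← map_sub, ← Real.norm_eq_abs, h1, mul_assoc]
    exact ψ.le_of_opNorm_le_of_le le_rfl (hC s hs r hr hsr)
  simp only [hw] at hwab
  rw [hG a ⟨le_rfl, hab⟩, hG b ⟨hab, le_rfl⟩, hT.1, intervalIntegral.integral_same, sub_zero,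
    intervalIntegral.integral_symm, sub_neg_eq_add] at hwab
  rw [one_apply_eq_self] at hwab
  rw [← hwab]
  congr 1
  apply intervalIntegral.integral_congr
  intro τ hτ
  rw [Set.uIcc_of_le hab] at hτ
  simp only [hG τ hτ]
end
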